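/- Let R = k[x_1,…,x_n] be a standard graded polynomial ring over an infinite field, and let M ≠ 0 be a finitely generated ℤ-graded R-module with depth(M) > 0 and Edepth(M) > 0. If ℓ is a linear form which is strictly filter regular for M, then the graded short exact sequence 0 → M(−1) →ℓ M → M/ℓM → 0 induces graded short exact sequences 0 → Ext^i_R(M,R) →ℓ Ext^i_R(M,R)(1) → Ext^{i+1}_R(M/ℓM,R) → 0 for all i < n, and 0 → H^{i−1}_m(M/ℓM) → H^i_m(M)(−1) →ℓ H^i_m(M) → 0 for all i > 0. -/

import Mathlib

open CategoryTheory

noncomputable section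

/-- The (Krull) dimension of a module: the Krull dimension of its support.
The dimension of the zero module is `⊥` (thought of as `-1`). -/
noncomputable def mDim (R : Type) [CommRing R] (M : Type) [AddCommGroup M] [Module R M] :
    WithBot ℕ∞ :=
  Order.krullDim (Module.support R M)

/-- The `i`-th Ext module `Ext_R^i(A, B)` (as a type). -/
noncomputable abbrev extC (R : Type) [CommRing R] (i : ℕ) (A B : Type)
    [AddCommGroup A] [Module R A] [AddCommGroup B] [Module R B] : Type :=
  ↥(((Ext R (ModuleCat R) i).obj (Opposite.op (ModuleCat.of R A))).obj (ModuleCat.of R B))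

/-- The depth of a module `M` with respect to an ideal `I`:
the least `i` such that `Ext_R^i(R/I, M) ≠ 0` (and `⊤` if there is no such `i`,
in particular the depth of the zero module is `⊤ = +∞`). -/
noncomputable def mDepth (R : Type) [CommRing R] (I : Ideal R) (M : Type)
    [AddCommGroup M] [Module R M] : ℕ∞ :=
  sInf {i : ℕ∞ | ∃ j : ℕ, i = j ∧ Nontrivial (extC R j (R ⧸ I) M)}

/-- `M` is a Cohen-Macaulay module (with respect to the (maximal) ideal `I`) if it is
nonzero and its depth equals its dimension. -/
def IsCM (R : Type) [CommRing R] (I : Ideal R) (M : Type) [AddCommGroup M] [Module R M] :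
    Prop :=
  Nontrivial M ∧ (mDepth R I M : WithBot ℕ∞) = mDim R M

/-- The subquotient `N'/N` of a module (most meaningful when `N ≤ N'`). -/
abbrev subQuot (R : Type) [CommRing R] {M : Type} [AddCommGroup M] [Module R M]
    (N N' : Submodule R M) : Type :=
  N' ⧸ (Submodule.comap N'.subtype N)

/-- `F 0 = 0 ⊊ F 1 ⊊ ⋯ ⊊ F r = M` is a sCM filtration: each quotient `F (i+1) / F i`
is Cohen-Macaulay and the dimensions of the quotients are strictly increasing. -/
def IsSCMFil (R : Type) [CommRing R] (I : Ideal R) {M : Type} [AddCommGroup M] [Module R M]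
    (r : ℕ) (F : ℕ → Submodule R M) : Prop :=
  F 0 = ⊥ ∧ F r = ⊤ ∧ (∀ i < r, F i < F (i + 1)) ∧
    (∀ i < r, IsCM R I (subQuot R (F i) (F (i + 1)))) ∧
    (∀ i, i + 1 < r →
      mDim R (subQuot R (F i) (F (i + 1))) < mDim R (subQuot R (F (i + 1)) (F (i + 2))))

/-- `M` is sequentially Cohen-Macaulay if it admits a sCM filtration. -/
def IsSeqCM (R : Type) [CommRing R] (I : Ideal R) (M : Type) [AddCommGroup M] [Module R M] :
    Prop :=
  ∃ (r : ℕ) (F : ℕ → Submodule R M), IsSCMFil R I r F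

/-- `δ_c(M)`: the largest submodule of `M` of dimension at most `c`. -/
noncomputable def deltaSub (R : Type) [CommRing R] (M : Type) [AddCommGroup M] [Module R M]
    (c : ℕ) : Submodule R M :=
  sSup {N : Submodule R M | mDim R ↥N ≤ (c : WithBot ℕ∞)}

/-- `δ_{c-1}(M)`, with `δ_{-1}(M) = 0`. -/
noncomputable def deltaSubPred (R : Type) [CommRing R] (M : Type) [AddCommGroup M] [Module R M] :
    ℕ → Submodule R M
  | 0 => ⊥
  | (c + 1) => deltaSub R M c

/-- `H^0_I(M)`, the `I`-power-torsion submodule of `M`. -/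
noncomputable def tors (R : Type) [CommRing R] (I : Ideal R) (M : Type) [AddCommGroup M]
    [Module R M] : Submodule R M :=
  ⨆ t : ℕ, Submodule.torsionBySet R M ((I ^ t : Ideal R) : Set R)

end
noncomputable section

/-- The homogeneous maximal (irrelevant) ideal `𝔪 = (x_1, …, x_n)` of `k[x_1, …, x_n]`. -/
noncomputable def irrIdeal (k : Type) [Field k] (n : ℕ) : Ideal (MvPolynomial (Fin n) k) :=
  Ideal.span (Set.range MvPolynomial.X)

/-- The linear form with coefficients `a : Fin n → k`. -/
noncomputable def linForm (k : Type) [Field k] (n : ℕ) (a : Fin n → k) :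
    MvPolynomial (Fin n) k :=
  ∑ i : Fin n, MvPolynomial.C (a i) * MvPolynomial.X i

/-- Given a ℤ-graded module `M` over `k[x_1, …, x_n]` with grading `𝒜`, a submodule `N` is
graded (homogeneous) if it is spanned by its homogeneous elements. -/
def IsGradedSub (k : Type) [Field k] (n : ℕ) (M : Type) [AddCommGroup M]
    [Module (MvPolynomial (Fin n) k) M] [Module k M]
    [IsScalarTower k (MvPolynomial (Fin n) k) M]
    (𝒜 : ℤ → Submodule k M) (N : Submodule (MvPolynomial (Fin n) k) M) : Prop :=
  N.restrictScalars k ≤ ⨆ e : ℤ, (N.restrictScalars k ⊓ 𝒜 e)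

/-- `δ_c(M/N)`: the largest graded submodule of `M/N` of dimension at most `c`, encoded as a
submodule of `M` containing `N`. -/
noncomputable def deltaPairG (k : Type) [Field k] (n : ℕ) (M : Type) [AddCommGroup M]
    [Module (MvPolynomial (Fin n) k) M] [Module k M]
    [IsScalarTower k (MvPolynomial (Fin n) k) M]
    (𝒜 : ℤ → Submodule k M) (N : Submodule (MvPolynomial (Fin n) k) M) (c : ℕ) :
    Submodule (MvPolynomial (Fin n) k) M :=
  sSup {P | N ≤ P ∧ IsGradedSub k n M 𝒜 P ∧
    mDim (MvPolynomial (Fin n) k) (subQuot (MvPolynomial (Fin n) k) N P) ≤ (c : WithBot ℕ∞)}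

/-- `δ_{c-1}(M/N)`, with the convention `δ_{-1} = 0` (i.e. `N` as a submodule of `M`). -/
noncomputable def deltaPairGPred (k : Type) [Field k] (n : ℕ) (M : Type) [AddCommGroup M]
    [Module (MvPolynomial (Fin n) k) M] [Module k M]
    [IsScalarTower k (MvPolynomial (Fin n) k) M]
    (𝒜 : ℤ → Submodule k M) (N : Submodule (MvPolynomial (Fin n) k) M) :
    ℕ → Submodule (MvPolynomial (Fin n) k) M
  | 0 => N
  | (c + 1) => deltaPairG k n M 𝒜 N c

/-- The quotient `M/N` (of the graded module `M` by a graded submodule `N`) is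
`i`-partially sequentially Cohen-Macaulay: the quotients `δ_j/δ_{j-1}` of its dimension
filtration (by largest graded submodules of dimension `≤ j`) are zero or Cohen-Macaulay
for all `j ≥ i`. -/
noncomputable def IsPartiallySCM (k : Type) [Field k] (n : ℕ) (M : Type) [AddCommGroup M]
    [Module (MvPolynomial (Fin n) k) M] [Module k M]
    [IsScalarTower k (MvPolynomial (Fin n) k) M]
    (𝒜 : ℤ → Submodule k M) (N : Submodule (MvPolynomial (Fin n) k) M) (i : ℕ) : Prop :=
  ∀ j : ℕ, i ≤ j →
    Subsingleton (subQuot (MvPolynomial (Fin n) k)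
      (deltaPairGPred k n M 𝒜 N j) (deltaPairG k n M 𝒜 N j)) ∨
    IsCM (MvPolynomial (Fin n) k) (irrIdeal k n)
      (subQuot (MvPolynomial (Fin n) k)
        (deltaPairGPred k n M 𝒜 N j) (deltaPairG k n M 𝒜 N j))

end
noncomputable section
/-- The `j`-th local cohomology module `H^j_𝔪(A)` of a module `A` over `k[x_1, …, x_n]`,
with support in the homogeneous maximal ideal `𝔪`, as a type. -/
noncomputable abbrev locCoh (k : Type) [Field k] (n : ℕ) (j : ℕ) (A : Type) [AddCommGroup A]
    [Module (MvPolynomial (Fin n) k) A] : Type :=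
  ↥((localCohomology (irrIdeal k n) j).obj (ModuleCat.of (MvPolynomial (Fin n) k) A))
end
noncomputable section

/-- Condition `(E_r)` for a module `M` over `R = k[x_1, …, x_n]`:
`depth (Ext^i_R(M, R)) ≥ min {r, n - i}` for all `i` (depths taken with respect to the
homogeneous maximal ideal; the depth of the zero module is `⊤ = +∞`). -/
def satE (k : Type) [Field k] (n : ℕ) (M : Type) [AddCommGroup M]
    [Module (MvPolynomial (Fin n) k) M] (r : ℕ) : Prop :=
  ∀ i : ℕ, min (r : ℕ∞) ((n : ℕ∞) - (i : ℕ∞)) ≤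
    mDepth (MvPolynomial (Fin n) k) (irrIdeal k n)
      (extC (MvPolynomial (Fin n) k) i M (MvPolynomial (Fin n) k))

/-- `Edepth(M) = min {n, sup {r ∈ ℕ | M satisfies (E_r)}}`. -/
noncomputable def eDepth (k : Type) [Field k] (n : ℕ) (M : Type) [AddCommGroup M]
    [Module (MvPolynomial (Fin n) k) M] : ℕ∞ :=
  min (n : ℕ∞) (sSup {r : ℕ∞ | ∃ m : ℕ, r = (m : ℕ∞) ∧ satE k n M m})

/-- `x` is a strictly filter regular element for `M`: `0 ≠ x ∈ 𝔪` lies outside every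
associated prime different from `𝔪` of `X(M) = ⊕_{i ∈ ℕ} Ext^i_R(M, R)` (equivalently,
of each `Ext^i_R(M, R)`). -/
def IsSFRg (k : Type) [Field k] (n : ℕ) (x : MvPolynomial (Fin n) k) (M : Type)
    [AddCommGroup M] [Module (MvPolynomial (Fin n) k) M] : Prop :=
  x ≠ 0 ∧ x ∈ irrIdeal k n ∧
    ∀ i : ℕ, ∀ p ∈ associatedPrimes (MvPolynomial (Fin n) k)
      (extC (MvPolynomial (Fin n) k) i M (MvPolynomial (Fin n) k)),
      p ≠ irrIdeal k n → x ∉ p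

end
section Bridge
open CategoryTheory Limits

section generic
universe v u
variable {E : Type u} [Category.{v} E] [Abelian E] (K : ChainComplex E ℕ) {I : E}

noncomputable def gMk (n : ℕ) (f : K.X n ⟶ I) (hf : K.d (n+1) n ≫ f = 0) : K.homology n ⟶ I :=
  K.homologyι n ≫ K.descOpcycles f (n+1) (by simp) hf

lemma gMk_surj [Injective I] (n : ℕ) (h : K.homology n ⟶ I) :
    ∃ f hf, gMk K n f hf = h := by
  refine ⟨K.pOpcycles n ≫ Injective.factorThru h (K.homologyι n), by simp, ?_⟩
  rw [gMk]
  have : K.descOpcycles (K.pOpcycles n ≫ Injective.factorThru h (K.homologyι n)) (n+1)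
    (by simp) (by simp) = Injective.factorThru h (K.homologyι n) := by
    rw [← cancel_epi (K.pOpcycles n)]; simp
  rw [this]; simp

lemma gMk_eq_zero_iff [Injective I] (n : ℕ) (f : K.X (n+1) ⟶ I)
    (hf : K.d (n+1+1) (n+1) ≫ f = 0) :
    gMk K (n+1) f hf = 0 ↔ ∃ g : K.X n ⟶ I, K.d (n+1) n ≫ g = f := by
  constructor
  · intro h
    have hS : (ShortComplex.mk (K.homologyι (n+1)) (K.fromOpcycles (n+1) n) (by simp)).Exact :=
      ShortComplex.exact_of_f_is_kernel _ (K.homologyIsKernel (n+1) n (by simp))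
    have := hS.descToInjective (K.descOpcycles f (n+1+1) (by simp) hf) h
    refine ⟨hS.descToInjective (K.descOpcycles f (n+1+1) (by simp) hf) h, ?_⟩
    have h2 := hS.comp_descToInjective (K.descOpcycles f (n+1+1) (by simp) hf) h
    dsimp at h2
    rw [← K.p_fromOpcycles, Category.assoc, h2]; simp
  · rintro ⟨g, rfl⟩
    rw [gMk]
    have : K.descOpcycles (K.d (n+1) n ≫ g) (n+1+1) (by simp) hf = K.fromOpcycles (n+1) n ≫ g := by
      rw [← cancel_epi (K.pOpcycles (n+1))]; simp
    rw [this]; simp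

lemma gMk_zero_eq_zero_iff (f : K.X 0 ⟶ I) (hf : K.d 1 0 ≫ f = 0) :
    gMk K 0 f hf = 0 ↔ f = 0 := by
  constructor
  · intro h
    rw [gMk] at h
    have : IsIso (K.homologyι 0) := K.isIso_homologyι 0 0 (by simp) (by simp)
    have h2 : K.descOpcycles f 1 (by simp) hf = 0 := by
      rw [← cancel_epi (K.homologyι 0)]; simpa using h
    have := K.p_descOpcycles f 1 (by simp) hf
    rw [← this, h2]; simp
  · rintro rfl
    rw [gMk]
    have : K.descOpcycles (0 : K.X 0 ⟶ I) 1 (by simp) hf = 0 := by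
      rw [← cancel_epi (K.pOpcycles 0)]; simp
    rw [this]; simp

lemma gMk_add (n : ℕ) (f g : K.X n ⟶ I) (hf : K.d (n+1) n ≫ f = 0) (hg : K.d (n+1) n ≫ g = 0) :
    gMk K n (f+g) (by simp [hf, hg]) = gMk K n f hf + gMk K n g hg := by
  rw [gMk, gMk, gMk]
  refine Eq.trans ?_ (Preadditive.comp_add _ _ _ _ _ _)
  congr 1
  rw [← cancel_epi (K.pOpcycles n)]; simp

lemma gMk_comp (n : ℕ) (f : K.X n ⟶ I) (hf : K.d (n+1) n ≫ f = 0) {I' : E} (g : I ⟶ I') :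
    gMk K n (f ≫ g) (by simp [reassoc_of% hf]) = gMk K n f hf ≫ g := by
  rw [gMk, gMk, Category.assoc]
  congr 1
  rw [← cancel_epi (K.pOpcycles n)]; simp

lemma gMk_map {K' : ChainComplex E ℕ} (φ : K' ⟶ K) (n : ℕ) (f : K.X n ⟶ I)
    (hf : K.d (n+1) n ≫ f = 0) :
    HomologicalComplex.homologyMap φ n ≫ gMk K n f hf =
      gMk K' n (φ.f n ≫ f) (by rw [← φ.comm_assoc, hf, comp_zero]) := by
  rw [gMk, gMk, ← Category.assoc, HomologicalComplex.homologyι_naturality, Category.assoc]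
  congr 1
  rw [← cancel_epi (K'.pOpcycles n)]; simp
end generic

variable {R : Type} [CommRing R] 

abbrev yoF (Y : ModuleCat.{0} R) : ModuleCat.{0} R ⥤ (ModuleCat.{0} R)ᵒᵖ :=
  ((linearYoneda R (ModuleCat.{0} R)).obj Y).rightOp

abbrev spOp {X Y : ModuleCat.{0} R} (f : X ⟶ Y) : (yoF Y).obj X ⟶ Opposite.op (ModuleCat.of R R) :=
  (ModuleCat.ofHom (LinearMap.toSpanSingleton R (X ⟶ Y) f)).op

variable {X Y : ModuleCat.{0} R} (P : ProjectiveResolution X)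

lemma map_spOp {X' X : ModuleCat.{0} R} (g : X' ⟶ X) (f : X ⟶ Y) :
    (yoF Y).map g ≫ spOp f = spOp (g ≫ f) := by
  apply Quiver.Hom.unop_inj
  apply ModuleCat.hom_ext
  apply LinearMap.ext_ring
  change g ≫ ((1:R) • f) = (1:R) • (g ≫ f)
  simp

lemma spOp_zero  {X Y : ModuleCat.{0} R} : spOp (0 : X ⟶ Y) = 0 := by
  apply Quiver.Hom.unop_inj
  apply ModuleCat.hom_ext
  apply LinearMap.ext_ring
  change (1:R) • (0 : X ⟶ Y) = 0
  simp

lemma spOp_add  {X Y : ModuleCat.{0} R} (f g : X ⟶ Y) : spOp (f + g) = spOp f + spOp g := by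
  apply Quiver.Hom.unop_inj
  apply ModuleCat.hom_ext
  apply LinearMap.ext_ring
  change (1:R) • (f + g) = (1 : R) • f + (1 : R) • g
  simp

lemma spOp_surj  {X Y : ModuleCat.{0} R} (h : (yoF Y).obj X ⟶ Opposite.op (ModuleCat.of R R)) :
    ∃ f : X ⟶ Y, spOp f = h := by
  refine ⟨h.unop.hom (1 : R), ?_⟩
  apply Quiver.Hom.unop_inj
  apply ModuleCat.hom_ext
  apply LinearMap.ext_ring
  exact one_smul R _

lemma spOp_inj  {X Y : ModuleCat.{0} R} {f g : X ⟶ Y} (h : spOp f = spOp g) : f = g := by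
  have := congrArg (fun h => h.unop.hom (1:R)) h
  have : (1:R) • f = (1:R) • g := this
  simpa using this

lemma spOp_smul  {X Y : ModuleCat.{0} R} (r : R) (f : X ⟶ Y) : 
   spOp (r • f) = spOp f ≫ (ModuleCat.ofHom (LinearMap.lsmul R R r)).op := by
  apply Quiver.Hom.unop_inj
  apply ModuleCat.hom_ext
  apply LinearMap.ext_ring
  change (1:R) • (r • f) = (r • (1 : R)) • f 
  simp

variable (Y) in
noncomputable def yoK : ChainComplex (ModuleCat.{0} R)ᵒᵖ ℕ :=
  ((yoF Y).mapHomologicalComplex _).obj P.complex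

noncomputable def spK {n : ℕ} (f : P.complex.X n ⟶ Y) :
    (yoK Y P).X n ⟶ Opposite.op (ModuleCat.of R R) := spOp f

variable (Y) in
noncomputable def oldIso (n : ℕ) : ((yoF Y).leftDerived n).obj X ≅ (yoK Y P).homology n :=
  P.isoLeftDerivedObj (yoF Y) n

lemma d_spK {n m : ℕ} (f : P.complex.X n ⟶ Y) :
    (yoK Y P).d m n ≫ spK P f = spK P (P.complex.d m n ≫ f) := map_spOp _ _

lemma spK_zero {n : ℕ} : spK P (0 : P.complex.X n ⟶ Y) = 0 := spOp_zero

lemma spK_add {n : ℕ} (f g : P.complex.X n ⟶ Y) : spK P (f + g) = spK P f + spK P g := spOp_add f g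

lemma spK_smul {n : ℕ} (r : R) (f : P.complex.X n ⟶ Y) :
    spK P (r • f) = spK P f ≫ (ModuleCat.ofHom (LinearMap.lsmul R R r)).op := spOp_smul r f

lemma spK_surj {n : ℕ} (h : (yoK Y P).X n ⟶ Opposite.op (ModuleCat.of R R)) :
    ∃ f, spK P f = h := spOp_surj (X := P.complex.X n) h

lemma spK_inj {n : ℕ} {f g : P.complex.X n ⟶ Y} (h : spK P f = spK P g) : f = g := spOp_inj h

lemma oldMor_aux {n : ℕ} {f : P.complex.X n ⟶ Y} (hf : P.complex.d (n+1) n ≫ f = 0) :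
   (yoK Y P).d (n+1) n ≫ spK P f = 0 := by rw [d_spK, hf, spK_zero]

noncomputable def oldMor {n : ℕ} (f : P.complex.X n ⟶ Y) (hf : P.complex.d (n+1) n ≫ f = 0) :
    ((yoF Y).leftDerived n).obj X ⟶ Opposite.op (ModuleCat.of R R) :=
  (oldIso Y P n).hom ≫ gMk (yoK Y P) n (spK P f) (oldMor_aux P hf)

noncomputable def oldMk {n : ℕ} (f : P.complex.X n ⟶ Y) (hf : P.complex.d (n+1) n ≫ f = 0) :
    ((Ext R (ModuleCat.{0} R) n).obj (Opposite.op X)).obj Y :=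
  (oldMor P f hf).unop.hom (1 : R)

variable (Y) in
noncomputable def yoMap {X' : ModuleCat.{0} R} {P : ProjectiveResolution X}
    {P' : ProjectiveResolution X'} {g : X' ⟶ X}
    (φ : P'.Hom P g) : yoK Y P' ⟶ yoK Y P := ((yoF Y).mapHomologicalComplex _).map φ.hom

lemma oldMor_map {X' : ModuleCat.{0} R} {P' : ProjectiveResolution X'} {g : X' ⟶ X}
    (φ : P'.Hom P g) {n : ℕ} (f : P.complex.X n ⟶ Y) (hf : P.complex.d (n+1) n ≫ f = 0) :
    ((yoF Y).leftDerived n).map g ≫ oldMor P f hf = 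
      oldMor P' (φ.hom.f n ≫ f) (by simp [← φ.hom.comm_assoc, hf]) := by
  have h1 : ((yoF Y).leftDerived n).map g ≫ (oldIso Y P n).hom = (oldIso Y P' n).hom ≫
    HomologicalComplex.homologyMap (yoMap Y φ) n :=
    P'.isoLeftDerivedObj_hom_naturality g P φ.hom φ.hom_f_zero_comp_π_f_zero (yoF Y) n
  rw [oldMor, oldMor, ← Category.assoc, h1, Category.assoc]
  congr 1
  refine (gMk_map _ _ _ _ _).trans ?_
  congr 1

instance : Injective (Opposite.op (ModuleCat.of R R)) := by
  have : Projective (ModuleCat.of R R) := inferInstance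
  infer_instance

lemma oldMk_add {n : ℕ} (f g : P.complex.X n ⟶ Y) (hf : P.complex.d (n+1) n ≫ f = 0)
    (hg : P.complex.d (n+1) n ≫ g = 0) :
    oldMk P (f + g) (by rw [Preadditive.comp_add, hf, hg, add_zero]) = oldMk P f hf + oldMk P g hg := by
  have : oldMor P (f + g) (by rw [Preadditive.comp_add, hf, hg, add_zero]) = oldMor P f hf + oldMor P g hg := by
    rw [oldMor, oldMor, oldMor]
    refine Eq.trans ?_ (Preadditive.comp_add _ _ _ _ _ _)
    congr 1
    rw [← gMk_add]
    congr 1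
    exact spK_add P f g
  rw [oldMk, this]
  rfl

lemma oldMk_smul {n : ℕ} (r : R) (f : P.complex.X n ⟶ Y) (hf : P.complex.d (n+1) n ≫ f = 0) :
    oldMk P (r • f) (by rw [Linear.comp_smul, hf, smul_zero]) = r • oldMk P f hf := by
  have : oldMor P (r • f) (by rw [Linear.comp_smul, hf, smul_zero]) =
      oldMor P f hf ≫ (ModuleCat.ofHom (LinearMap.lsmul R R r)).op := by
    rw [oldMor, oldMor, Category.assoc]
    congr 1
    rw [← gMk_comp]
    congr 1
    exact spK_smul P r f
  rw [oldMk, this, oldMk]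
  change (oldMor P f hf).unop.hom (r • (1:R)) = _
  exact map_smul _ _ _

lemma oldMk_surj {n : ℕ} (x : ((Ext R (ModuleCat.{0} R) n).obj (Opposite.op X)).obj Y) :
    ∃ f hf, oldMk P f hf = x := by
  let h : ((yoF Y).leftDerived n).obj X ⟶ Opposite.op (ModuleCat.of R R) :=
    (ModuleCat.ofHom (LinearMap.toSpanSingleton R _ x)).op
  obtain ⟨f, hf, hh⟩ := gMk_surj _ _ ((oldIso Y P n).inv ≫ h)
  obtain ⟨g, rfl⟩ := spK_surj P f
  refine ⟨g, ?_, ?_⟩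
  · apply spK_inj P
    rw [← d_spK, spK_zero]
    exact hf
  · rw [oldMk, oldMor, hh, Iso.hom_inv_id_assoc]
    exact one_smul R x

lemma oldMk_eq_zero {n : ℕ} (f : P.complex.X n ⟶ Y) (hf : P.complex.d (n+1) n ≫ f = 0) :
    oldMk P f hf = 0 ↔ gMk (yoK Y P) n (spK P f) (oldMor_aux P hf) = 0 := by
  constructor
  · intro h
    have : oldMor P f hf = 0 := by
      apply Quiver.Hom.unop_inj
      apply ModuleCat.hom_ext
      apply LinearMap.ext_ring
      exact h
    rw [oldMor] at this
    rw [← cancel_epi (oldIso Y P n).hom, this, comp_zero]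
  · intro h
    rw [oldMk, oldMor, h, comp_zero]
    rfl

lemma oldMk_eq_zero_iff {n : ℕ} (f : P.complex.X (n+1) ⟶ Y)
    (hf : P.complex.d (n+1+1) (n+1) ≫ f = 0) :
    oldMk P f hf = 0 ↔ ∃ g : P.complex.X n ⟶ Y, P.complex.d (n+1) n ≫ g = f := by
  rw [oldMk_eq_zero, gMk_eq_zero_iff]
  constructor
  · rintro ⟨g, hg⟩
    obtain ⟨g, rfl⟩ := spK_surj P g
    exact ⟨g, spK_inj P ((d_spK _ _).symm.trans hg)⟩
  · rintro ⟨g, rfl⟩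
    exact ⟨spK P g, d_spK _ _⟩

lemma oldMk_zero_eq_zero_iff (f : P.complex.X 0 ⟶ Y) (hf : P.complex.d 1 0 ≫ f = 0) :
    oldMk P f hf = 0 ↔ f = 0 := by
  rw [oldMk_eq_zero, gMk_zero_eq_zero_iff]
  constructor
  · intro h
    exact spK_inj P (h.trans (spK_zero P).symm)
  · rintro rfl
    exact spK_zero P

lemma oldMk_map {X' : ModuleCat.{0} R} {P' : ProjectiveResolution X'} {g : X' ⟶ X}
    (φ : P'.Hom P g) {n : ℕ} (f : P.complex.X n ⟶ Y) (hf : P.complex.d (n+1) n ≫ f = 0) :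
    ((Ext R (ModuleCat.{0} R) n).map g.op).app Y (oldMk P f hf) = 
      oldMk P' (φ.hom.f n ≫ f) (by simp [← φ.hom.comm_assoc, hf]) := by
  rw [oldMk, oldMk, ← oldMor_map]
  rfl

/-! new Ext -/
open Abelian

lemma newMk_smul {n : ℕ} (r : R) (f : P.complex.X n ⟶ Y) (hf : P.complex.d (n+1) n ≫ f = 0) :
    P.extMk (r • f) (n+1) rfl (by simp [hf]) = r • P.extMk f (n+1) rfl hf := by
  rw [Ext.smul_eq_comp_mk₀, ProjectiveResolution.extMk_comp_mk₀]
  congr 1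

lemma newMk_zero_eq_zero_iff (f : P.complex.X 0 ⟶ Y) (hf : P.complex.d 1 0 ≫ f = 0) :
    P.extMk f 1 rfl hf = 0 ↔ f = 0 := by
  constructor
  · intro h
    rw [← P.extEquivCohomologyClass.apply_eq_iff_eq,
      ProjectiveResolution.extEquivCohomologyClass_extMk,
      ProjectiveResolution.extEquivCohomologyClass_zero,
      CochainComplex.HomComplex.CohomologyClass.mk_eq_zero_iff,
      CochainComplex.HomComplex.Cocycle.toSingleMk_mem_coboundaries_iff _ _ _ _ _ 1 (by simp)] at h
    obtain ⟨g, hg⟩ := h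
    have : IsZero (P.cochainComplex.X 1) := P.cochainComplex.isZero_of_isStrictlyLE 0 1 (by simp)
    rw [this.eq_of_src g 0, comp_zero] at hg
    rw [← cancel_epi (P.cochainComplexXIso (-(0:ℕ)) 0 rfl).hom, ← hg, comp_zero]
  · rintro rfl
    simp

variable (Y) in
def cocyc (n : ℕ) : Submodule R (P.complex.X n ⟶ Y) where
  carrier := {f | P.complex.d (n+1) n ≫ f = 0}
  add_mem' := by intro a b ha hb; simp_all
  zero_mem' := by simp
  smul_mem' := by intro r a ha; simp_all

variable (Y) in
noncomputable def oldL (n : ℕ) : cocyc Y P n →ₗ[R] extC R n X Y where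
  toFun f := oldMk P f.1 f.2
  map_add' f g := oldMk_add P _ _ f.2 g.2
  map_smul' r f := oldMk_smul P r _ f.2

variable (Y) in
noncomputable def newL (n : ℕ) : cocyc Y P n →ₗ[R] Ext X Y n where
  toFun f := P.extMk f.1 (n+1) rfl f.2
  map_add' f g := (P.add_extMk _ _ _ rfl f.2 g.2).symm
  map_smul' r f := newMk_smul P r _ f.2

variable (Y) in
lemma ker_oldL (n : ℕ) : LinearMap.ker (oldL Y P n) = LinearMap.ker (newL Y P n) := by
  ext ⟨f, hf⟩
  change oldMk P f hf = 0 ↔ P.extMk f (n+1) rfl hf = 0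
  cases n with
  | zero => exact (oldMk_zero_eq_zero_iff P f hf).trans (newMk_zero_eq_zero_iff P f hf).symm
  | succ n => exact (oldMk_eq_zero_iff P f hf).trans (P.extMk_eq_zero_iff f _ rfl hf n rfl).symm

variable (Y) in
lemma oldL_surj (n : ℕ) : Function.Surjective (oldL Y P n) := fun x => by
    obtain ⟨f, hf, h⟩ := oldMk_surj P x
    exact ⟨⟨f, hf⟩, h⟩

variable (Y) in
lemma newL_surj (n : ℕ) : Function.Surjective (newL Y P n) := fun x => by
    obtain ⟨f, hf, h⟩ := P.extMk_surjective x _ rfl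
    exact ⟨⟨f, hf⟩, h⟩

variable (X Y) in
noncomputable def bridgeC (n : ℕ) : extC R n X Y ≃ₗ[R] Ext X Y n :=
  let P := projectiveResolution X
  ((oldL Y P n).quotKerEquivOfSurjective (oldL_surj Y P n)).symm ≪≫ₗ
    Submodule.quotEquivOfEq _ _ (ker_oldL Y P n) ≪≫ₗ
  ((newL Y P n).quotKerEquivOfSurjective (newL_surj Y P n))

lemma bridgeC_mk {n : ℕ} (f : (projectiveResolution X).complex.X n ⟶ Y) (hf) :
    bridgeC X Y n (oldMk (projectiveResolution X) f hf) = 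
      (projectiveResolution X).extMk f (n+1) rfl hf := by
  rw [bridgeC]
  simp only [LinearEquiv.trans_apply]
  have : oldMk (projectiveResolution X) f hf = 
    oldL Y (projectiveResolution X) n ⟨f, hf⟩ := rfl
  have h2 : ((oldL Y (projectiveResolution X) n).quotKerEquivOfSurjective
      (oldL_surj Y _ n)).symm (oldMk (projectiveResolution X) f hf) =
        Submodule.Quotient.mk ⟨f, hf⟩ := by
    rw [LinearEquiv.symm_apply_eq]; rfl
  rw [h2]
  rfl

lemma bridgeC_map {X' : ModuleCat.{0} R} (g : X' ⟶ X) {n : ℕ} (x : extC R n X Y) :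
    bridgeC X' Y n (((Ext R (ModuleCat.{0} R) n).map g.op).app Y x) =
      (Ext.mk₀ g).comp (bridgeC X Y n x) (zero_add n) := by
  obtain ⟨f, hf, rfl⟩ := oldMk_surj (projectiveResolution X) x
  let φ : (projectiveResolution X').Hom (projectiveResolution X) g :=
    { hom := ProjectiveResolution.lift g _ _
      hom_f_zero_comp_π_f_zero := ProjectiveResolution.lift_commutes_zero _ _ _ }
  rw [oldMk_map _ φ, bridgeC_mk, bridgeC_mk, ProjectiveResolution.mk₀_comp_extMk _ _ _ _ φ]

end Bridge

noncomputable def bridge (R : Type) [CommRing R] (n : ℕ) (A B : Type) [AddCommGroup A] [Module R A]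
    [AddCommGroup B] [Module R B] :
    extC R n A B ≃ₗ[R] Abelian.Ext (ModuleCat.of R A) (ModuleCat.of R B) n :=
  bridgeC (ModuleCat.of R A) (ModuleCat.of R B) n

set_option linter.unusedVariables false

section B1

variable {R : Type} [CommRing R]

/-- new Ext between modules -/
abbrev EX (R : Type) [CommRing R] (A B : Type) [AddCommGroup A] [Module R A]
    [AddCommGroup B] [Module R B] (n : ℕ) : Type :=
  Abelian.Ext (ModuleCat.of R A) (ModuleCat.of R B) n

variable {A B C D : Type} [AddCommGroup A] [Module R A] [AddCommGroup B] [Module R B]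
  [AddCommGroup C] [Module R C] [AddCommGroup D] [Module R D]

noncomputable abbrev hm (f : A →ₗ[R] B) : EX R A B 0 := Abelian.Ext.mk₀ (ModuleCat.ofHom f)

lemma hm_comp (f : A →ₗ[R] B) (g : B →ₗ[R] C) :
    (hm f).comp (hm g) (zero_add 0) = hm (g ∘ₗ f) := by
  rw [Abelian.Ext.mk₀_comp_mk₀]; rfl

lemma hm_comp_assoc {n : ℕ} (f : A →ₗ[R] B) (g : B →ₗ[R] C) (x : EX R C D n) :
    (hm f).comp ((hm g).comp x (zero_add n)) (zero_add n) = (hm (g ∘ₗ f)).comp x (zero_add n) := by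
  rw [Abelian.Ext.mk₀_comp_mk₀_assoc]; rfl

lemma hm_surj (x : EX R A B 0) : ∃ f : A →ₗ[R] B, hm f = x := by
  obtain ⟨f, rfl⟩ := (Abelian.Ext.mk₀_bijective _ _).2 x
  exact ⟨f.hom, rfl⟩

lemma hm_inj {f g : A →ₗ[R] B} (h : hm f = hm g) : f = g := by
  have := (Abelian.Ext.mk₀_bijective _ _).1 h
  exact congrArg ModuleCat.Hom.hom this

lemma hm_zero : hm (0 : A →ₗ[R] B) = 0 := Abelian.Ext.mk₀_zero _ _

lemma hm_add (f g : A →ₗ[R] B) : hm (f + g) = hm f + hm g :=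
  Abelian.Ext.mk₀_add (ModuleCat.ofHom f) (ModuleCat.ofHom g)

lemma hm_smul (r : R) (f : A →ₗ[R] B) : hm (r • f) = r • hm f :=
  Abelian.Ext.mk₀_smul r (ModuleCat.ofHom f)

lemma hm_id_comp {n : ℕ} (x : EX R A B n) :
    (hm (LinearMap.id : A →ₗ[R] A)).comp x (zero_add n) = x := Abelian.Ext.mk₀_id_comp x

lemma comp_hm_id {n : ℕ} (x : EX R A B n) :
    x.comp (hm (LinearMap.id : B →ₗ[R] B)) (add_zero n) = x := Abelian.Ext.comp_mk₀_id x

lemma comp_hm_smul {n : ℕ} (r : R) (x : EX R A B n) :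
    x.comp (hm (r • (LinearMap.id : B →ₗ[R] B))) (add_zero n) = r • x := by
  rw [hm_smul, Abelian.Ext.comp_smul, comp_hm_id]

lemma hm_smul_comp {n : ℕ} (r : R) (x : EX R A B n) :
    (hm (r • (LinearMap.id : A →ₗ[R] A))).comp x (zero_add n) = r • x := by
  rw [hm_smul, Abelian.Ext.smul_comp, hm_id_comp]

/-- precomposition as linear map -/
noncomputable def preL (f : A →ₗ[R] B) (C : Type) [AddCommGroup C] [Module R C] (n : ℕ) :
    EX R B C n →ₗ[R] EX R A C n where
  toFun x := (hm f).comp x (zero_add n)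
  map_add' x y := Abelian.Ext.comp_add _ _ _ _
  map_smul' r x := Abelian.Ext.comp_smul _ _ _ _

lemma preL_apply {n : ℕ} (f : A →ₗ[R] B) (x : EX R B C n) :
    preL f C n x = (hm f).comp x (zero_add n) := rfl

lemma preL_preL {n : ℕ} (f : A →ₗ[R] B) (g : B →ₗ[R] C) (x : EX R C D n) :
    preL f D n (preL g D n x) = preL (g ∘ₗ f) D n x := hm_comp_assoc f g x

lemma preL_id {n : ℕ} (x : EX R A B n) : preL LinearMap.id B n x = x := hm_id_comp x

lemma preL_zero {n : ℕ} (x : EX R B C n) : preL (0 : A →ₗ[R] B) C n x = 0 := by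
  rw [preL_apply, hm_zero]; simp

lemma preL_add {n : ℕ} (f g : A →ₗ[R] B) (x : EX R B C n) :
    preL (f + g) C n x = preL f C n x + preL g C n x := by
  rw [preL_apply, hm_add]; exact Abelian.Ext.add_comp _ _ _ _

lemma preL_smul {n : ℕ} (r : R) (f : A →ₗ[R] B) (x : EX R B C n) :
    preL (r • f) C n x = r • preL f C n x := by
  rw [preL_apply, hm_smul]; exact Abelian.Ext.smul_comp _ _ _ _

lemma preL_sum {n : ℕ} {ι : Type*} (s : Finset ι) (f : ι → A →ₗ[R] B) (x : EX R B C n) :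
    preL (∑ i ∈ s, f i) C n x = ∑ i ∈ s, preL (f i) C n x := by
  classical
  induction s using Finset.induction_on with
  | empty => simp [preL_zero]
  | insert a s ha ih => rw [Finset.sum_insert ha, Finset.sum_insert ha, preL_add, ih]

lemma preL_comp {n m p : ℕ} (f : A →ₗ[R] B) (x : EX R B C n) (y : EX R C D m) (h : n + m = p) :
    preL f D p (x.comp y h) = (preL f C n x).comp y h := by
  rw [preL_apply, preL_apply, Abelian.Ext.comp_assoc]; omega

/-- the data of the long exact sequences attached to `0 → A → B → C → 0` -/
structure LES (f : A →ₗ[R] B) (g : B →ₗ[R] C) (δ : EX R C A 1) : Prop where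
  zero_fg : g ∘ₗ f = 0
  gd : (hm g).comp δ (zero_add 1) = 0
  df : δ.comp (hm f) (add_zero 1) = 0
  co1 : ∀ {X : Type} [AddCommGroup X] [Module R X] {n m : ℕ} (h : n + 1 = m) (x : EX R X A m),
    x.comp (hm f) (add_zero m) = 0 → ∃ y : EX R X C n, y.comp δ h = x
  co2 : ∀ {X : Type} [AddCommGroup X] [Module R X] {n : ℕ} (x : EX R X B n),
    x.comp (hm g) (add_zero n) = 0 → ∃ y : EX R X A n, y.comp (hm f) (add_zero n) = x
  co3 : ∀ {X : Type} [AddCommGroup X] [Module R X] {n m : ℕ} (h : n + 1 = m) (x : EX R X C n),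
    x.comp δ h = 0 → ∃ y : EX R X B n, y.comp (hm g) (add_zero n) = x
  con1 : ∀ {X : Type} [AddCommGroup X] [Module R X] {n m : ℕ} (h : 1 + n = m) (x : EX R A X n),
    δ.comp x h = 0 → ∃ y : EX R B X n, (hm f).comp y (zero_add n) = x
  con2 : ∀ {X : Type} [AddCommGroup X] [Module R X] {n : ℕ} (x : EX R B X n),
    (hm f).comp x (zero_add n) = 0 → ∃ y : EX R C X n, (hm g).comp y (zero_add n) = x
  con3 : ∀ {X : Type} [AddCommGroup X] [Module R X] {n m : ℕ} (h : 1 + n = m) (x : EX R C X m),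
    (hm g).comp x (zero_add m) = 0 → ∃ y : EX R A X n, δ.comp y h = x

lemma exists_LES (f : A →ₗ[R] B) (g : B →ₗ[R] C) (hf : Function.Injective f)
    (hg : Function.Surjective g) (hfg : Function.Exact f g) : ∃ δ, LES f g δ := by
  let S : ShortComplex (ModuleCat.{0} R) := ModuleCat.shortComplexOfCompEqZero f g hfg.linearMap_comp_eq_zero
  have hS : S.ShortExact :=
    { exact := (ShortComplex.ShortExact.moduleCat_exact_iff_function_exact S).mpr hfg
      mono_f := (ModuleCat.mono_iff_injective _).mpr hf
      epi_g := (ModuleCat.epi_iff_surjective _).mpr hg }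
  refine ⟨hS.extClass, ⟨hfg.linearMap_comp_eq_zero, hS.comp_extClass, hS.extClass_comp, ?_, ?_, ?_, ?_, ?_, ?_⟩⟩
  · intro X _ _ n m h x hx
    exact Abelian.Ext.covariant_sequence_exact₁ _ hS x hx h
  · intro X _ _ n x hx
    exact Abelian.Ext.covariant_sequence_exact₂ _ hS x hx
  · intro X _ _ n m h x hx
    exact Abelian.Ext.covariant_sequence_exact₃ _ hS x h hx
  · intro X _ _ n m h x hx
    exact Abelian.Ext.contravariant_sequence_exact₁ hS _ x h hx
  · intro X _ _ n x hx
    exact Abelian.Ext.contravariant_sequence_exact₂ hS _ x hx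
  · intro X _ _ n m h x hx
    exact Abelian.Ext.contravariant_sequence_exact₃ hS _ x hx h

lemma EX_projective [Module.Projective R A] {n : ℕ} (hn : 0 < n) (x : EX R A B n) : x = 0 := by
  obtain ⟨n, rfl⟩ := Nat.exists_eq_succ_of_ne_zero hn.ne'
  have : Projective (ModuleCat.of R A) := inferInstance
  exact Abelian.Ext.eq_zero_of_projective x

end B1

set_option linter.unusedVariables false

section B2

variable {R : Type} [CommRing R] 

def kil (I : Ideal R) (A : Type) [AddCommGroup A] [Module R A] : Prop := ∀ r ∈ I, ∀ a : A, r • a = 0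

variable {A B C D : Type} [AddCommGroup A] [Module R A] [AddCommGroup B] [Module R B]
  [AddCommGroup C] [Module R C] [AddCommGroup D] [Module R D]

lemma kil.of_inj {I : Ideal R} (h : kil I B) (f : A →ₗ[R] B) (hf : Function.Injective f) : kil I A := by
  intro r hr a
  apply hf
  rw [map_smul, map_zero, h r hr]

lemma kil.of_surj {I : Ideal R} (h : kil I A) (f : A →ₗ[R] B) (hf : Function.Surjective f) : kil I B := by
  intro r hr b
  obtain ⟨a, rfl⟩ := hf b
  rw [← map_smul, h r hr, map_zero]

lemma kil_quot (I : Ideal R) : kil I (R ⧸ I) := by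
  intro r hr a
  obtain ⟨a, rfl⟩ := Ideal.Quotient.mk_surjective a
  rw [Algebra.smul_def, Ideal.Quotient.algebraMap_eq, Ideal.Quotient.eq_zero_iff_mem.mpr hr, zero_mul]

lemma EX_vanish [IsNoetherianRing R] (m : Ideal R) (hm : m.IsMaximal) (N : Type) [AddCommGroup N]
    [Module R N] (i : ℕ) (h : ∀ e : EX R (R ⧸ m) N i, e = 0) (t : ℕ) (A : Type) [AddCommGroup A]
    [Module R A] (hA : Module.Finite R A) (hk : kil (m ^ t) A) (e : EX R A N i) : e = 0 := by
  revert e hk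
  induction hA using IsNoetherianRing.induction_on_isQuotientEquivQuotientPrime R with
  | subsingleton A =>
    intro _ e
    have : (LinearMap.id : A →ₗ[R] A) = 0 := by
      ext x; exact Subsingleton.elim _ _
    rw [← preL_id e, this, preL_zero]
  | quotient A p f =>
    intro hk e
    have h1 : p.1 = m := by
      have : m ^ t ≤ p.1 := by
        intro r hr
        have := hk r hr (f.symm 1)
        rw [← map_smul, LinearEquiv.map_eq_zero_iff, Algebra.smul_def, mul_one] at this
        exact Ideal.Quotient.eq_zero_iff_mem.mp this
      exact (hm.eq_of_le p.2.ne_top (p.2.le_of_pow_le this)).symm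
    obtain ⟨p, hp⟩ := p
    subst h1
    have := preL_id e
    rw [← this, show (LinearMap.id : A →ₗ[R] A) = f.symm.toLinearMap ∘ₗ f.toLinearMap by ext; simp,
      ← preL_preL, h (preL _ _ _ e), map_zero]
  | exact A B C f g hf hg hfg h1 h2 =>
    intro hk e
    obtain ⟨δ, hL⟩ := exists_LES f g hf hg hfg
    obtain ⟨y, rfl⟩ := hL.con2 e (h1 (hk.of_inj f hf) _)
    rw [h2 (hk.of_surj g hg) y, Abelian.Ext.comp_zero]

/-- the hypotheses for abstract local duality -/
structure LDat (R : Type) [CommRing R] (m : Ideal R) (n : ℕ) : Prop where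
  max : m.IsMaximal
  v1 : ∀ i < n, ∀ e : EX R (R ⧸ m) R i, e = 0
  v2 : ∀ i, n < i → ∀ (N : Type) [AddCommGroup N] [Module R N], ∀ e : EX R (R ⧸ m) N i, e = 0

variable [IsNoetherianRing R] {m : Ideal R} {n : ℕ} 

lemma LDat.V1 (L : LDat R m n) {t : ℕ} [Module.Finite R A] (hk : kil (m ^ t) A) {i : ℕ} (hi : i < n)
    (e : EX R A R i) : e = 0 :=
  EX_vanish m L.max _ _ (L.v1 i hi) t A inferInstance hk e

lemma LDat.V2 (L : LDat R m n) {t : ℕ} [Module.Finite R A] (hk : kil (m ^ t) A) {i : ℕ} (hi : n < i)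
    (e : EX R A B i) : e = 0 :=
  EX_vanish m L.max _ _ (L.v2 i hi B) t A inferInstance hk e

lemma kil_pi {ι : Type} {I : Ideal R} (h : kil I A) : kil I (ι → A) := by
  intro r hr a; ext i; exact h r hr (a i)

/-- element of Ext into a free module is determined by its components -/
lemma EX_free_ext {r i : ℕ} (e e' : EX R A (Fin r → R) i)
    (h : ∀ j, e.comp (hm (LinearMap.proj j)) (add_zero i) = 
      e'.comp (hm (LinearMap.proj j : (Fin r → R) →ₗ[R] R)) (add_zero i)) : e = e' := by
  have key : ∀ e : EX R A (Fin r → R) i, e = ∑ j : Fin r, 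
    (e.comp (hm (LinearMap.proj j : (Fin r → R) →ₗ[R] R)) (add_zero i)).comp 
      (hm (LinearMap.single R (fun _ => R) j)) (add_zero i) := by
    intro e
    have h0 : (LinearMap.id : (Fin r → R) →ₗ[R] _) = 
        ∑ j, LinearMap.single R (fun _ => R) j ∘ₗ (LinearMap.proj j : (Fin r → R) →ₗ[R] R) := by
      ext x j; simp
    have hs : ∀ s : Finset (Fin r), ∀ φ : Fin r → ((Fin r → R) →ₗ[R] (Fin r → R)),
      e.comp (hm (∑ j ∈ s, φ j)) (add_zero i) = ∑ j ∈ s, e.comp (hm (φ j)) (add_zero i) := by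
      intro s φ
      induction s using Finset.induction_on with
      | empty => simp [hm_zero]
      | insert a s ha ih => rw [Finset.sum_insert ha, Finset.sum_insert ha, hm_add,
          Abelian.Ext.comp_add, ih]
    conv_lhs => rw [← comp_hm_id e, h0, hs]
    refine Finset.sum_congr rfl fun j _ => ?_
    rw [← hm_comp, Abelian.Ext.comp_assoc_of_third_deg_zero]
  rw [key e, key e']
  simp only [h]

/-- constructing elements with prescribed components -/
lemma EX_free_mk {r i : ℕ} (c : Fin r → EX R A R i) : ∃ e : EX R A (Fin r → R) i,
    ∀ j, e.comp (hm (LinearMap.proj j)) (add_zero i) = c j := by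
  refine ⟨∑ j, (c j).comp (hm (LinearMap.single R (fun _ => R) j)) (add_zero i), fun j => ?_⟩
  have hs : ∀ s : Finset (Fin r), ∀ φ : Fin r → EX R A (Fin r → R) i,
      (∑ j ∈ s, φ j).comp (hm (LinearMap.proj j : (Fin r → R) →ₗ[R] R)) (add_zero i) = 
      ∑ l ∈ s, (φ l).comp (hm (LinearMap.proj j)) (add_zero i) := by
      intro s φ
      induction s using Finset.induction_on with
      | empty => simp
      | insert a s ha ih => rw [Finset.sum_insert ha, Finset.sum_insert ha, Abelian.Ext.add_comp, ih]
  rw [hs, Finset.sum_eq_single j]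
  · rw [Abelian.Ext.comp_assoc_of_third_deg_zero, hm_comp, LinearMap.proj_comp_single_same]
    exact comp_hm_id _
  · intro b _ hb
    rw [Abelian.Ext.comp_assoc_of_third_deg_zero, hm_comp, LinearMap.proj_comp_single_ne _ _ _ _ hb.symm,
      hm_zero, Abelian.Ext.comp_zero]
  · simp

lemma LDat.V1free (L : LDat R m n) {t r : ℕ} [Module.Finite R A] (hk : kil (m ^ t) A) {i : ℕ} (hi : i < n)
    (e : EX R A (Fin r → R) i) : e = 0 := by
  apply EX_free_ext
  intro j
  rw [L.V1 hk hi (e.comp _ _), L.V1 hk hi (Abelian.Ext.comp 0 _ _)]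

end B2

set_option linter.unusedVariables false
set_option linter.unusedSectionVars false

section B3

variable {R : Type} [CommRing R] 
variable {A B C D : Type} [AddCommGroup A] [Module R A] [AddCommGroup B] [Module R B]
  [AddCommGroup C] [Module R C] [AddCommGroup D] [Module R D]

/-- the projection `R/I → R/J` -/
abbrev qm {I J : Ideal R} (h : I ≤ J) : (R ⧸ I) →ₗ[R] (R ⧸ J) := Submodule.mapQ I J LinearMap.id h

lemma qm_surj {I J : Ideal R} (h : I ≤ J) : Function.Surjective (qm h) := by
  intro x
  obtain ⟨x, rfl⟩ := Submodule.mkQ_surjective _ x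
  exact ⟨Submodule.mkQ _ x, rfl⟩

lemma qm_qm {I J K : Ideal R} (h : I ≤ J) (h' : J ≤ K) : qm h' ∘ₗ qm h = qm (h.trans h') := by
  ext; rfl

/-- multiplication by a killed element -/
def mu {I : Ideal R} (hk : kil I A) (a : A) : (R ⧸ I) →ₗ[R] A :=
  Submodule.liftQ I (LinearMap.toSpanSingleton R A a) (fun r hr => hk r hr a)

lemma mu_one {I : Ideal R} (hk : kil I A) (a : A) : mu hk a 1 = a := by
  change (1 : R) • a = a
  exact one_smul _ _

lemma hom_quot_ext {I : Ideal R} {f g : (R ⧸ I) →ₗ[R] A} (h : f 1 = g 1) : f = g := by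
  ext; exact h

variable {m : Ideal R} {n : ℕ} [IsNoetherianRing R]

lemma LDat.preL_inj (L : LDat R m n) {t : ℕ} [Module.Finite R A] (hk : kil (m ^ t) A)
    (g : A →ₗ[R] B) (hg : Function.Surjective g) (y : EX R B R n) (hy : preL g R n y = 0) : y = 0 := by
  cases n with
  | zero =>
    obtain ⟨f, rfl⟩ := hm_surj y
    rw [preL_apply, hm_comp, ← hm_zero] at hy
    have := hm_inj hy
    have : f = 0 := by
      ext b
      obtain ⟨a, rfl⟩ := hg b
      exact LinearMap.congr_fun this a
    rw [this, hm_zero]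
  | succ n =>
    obtain ⟨δ, hL⟩ := exists_LES (LinearMap.ker g).subtype g (Submodule.subtype_injective _) hg
      (LinearMap.exact_subtype_ker_map g)
    obtain ⟨z, rfl⟩ := hL.con3 (add_comm _ _) y hy
    have hk' : kil (m ^ t) (LinearMap.ker g) := hk.of_inj _ (Submodule.subtype_injective _)
    rw [L.V1 hk' (Nat.lt_succ_self n) z, Abelian.Ext.comp_zero]

lemma pi_preL_ext {r : ℕ} (x : EX R (Fin r → A) C n)
    (h : ∀ j, preL (LinearMap.single R (fun _ : Fin r => A) j) C n x = 0) : x = 0 := by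
  have h0 : (LinearMap.id : (Fin r → A) →ₗ[R] _) = 
        ∑ j, LinearMap.single R (fun _ => A) j ∘ₗ (LinearMap.proj j : (Fin r → A) →ₗ[R] A) := by
      ext x j; simp
  rw [← preL_id x, h0, preL_sum]
  refine Finset.sum_eq_zero fun j _ => ?_
  rw [← preL_preL, h, map_zero]

lemma exists_fin_quot {I : Ideal R} [Module.Finite R A] (hk : kil I A) : 
    ∃ (r : ℕ) (a : Fin r → A), Function.Surjective 
      (⇑(∑ j, mu hk (a j) ∘ₗ (LinearMap.proj j : (Fin r → R ⧸ I) →ₗ[R] (R ⧸ I)) : 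
        (Fin r → R ⧸ I) →ₗ[R] A)) := by
  obtain ⟨r, f, hf⟩ := Module.Finite.exists_fin' R A
  refine ⟨r, fun j => f (Pi.single j 1), fun y => ?_⟩
  obtain ⟨c, rfl⟩ := hf y
  refine ⟨fun j => Submodule.mkQ I (c j), ?_⟩
  rw [LinearMap.sum_apply]
  have : c = ∑ j, c j • Pi.single j 1 := by
    ext l; simp [Pi.single_apply]
  conv_rhs => rw [this, map_sum]
  refine Finset.sum_congr rfl fun j _ => ?_
  rw [map_smul]
  rfl

lemma LDat.theta_surj (L : LDat R m n) {t : ℕ} [Module.Finite R A] (hk : kil (m ^ t) A)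
    (φ : A →ₗ[R] EX R (R ⧸ m ^ t) R n) : 
    ∃ ξ : EX R A R n, ∀ a, preL (mu hk a) R n ξ = φ a := by
  obtain ⟨r, a, hq⟩ := exists_fin_quot hk
  set q := ∑ j, mu hk (a j) ∘ₗ (LinearMap.proj j : (Fin r → R ⧸ m ^ t) →ₗ[R] (R ⧸ m ^ t)) with hqdef
  let ξ0 : EX R (Fin r → R ⧸ m ^ t) R n := ∑ j, preL (LinearMap.proj j) R n (φ (a j))
  have key : ∀ w : (R ⧸ m ^ t) →ₗ[R] (Fin r → R ⧸ m ^ t), preL w R n ξ0 = φ (q (w 1)) := by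
    intro w
    rw [map_sum, hqdef, LinearMap.sum_apply, map_sum]
    refine Finset.sum_congr rfl fun j _ => ?_
    obtain ⟨c, hc⟩ := Submodule.mkQ_surjective (m ^ t) (w 1 j)
    have h1 : LinearMap.proj j ∘ₗ w = c • LinearMap.id := by
      apply hom_quot_ext
      change w 1 j = _
      rw [← hc]
      change _ = c • Submodule.mkQ (m ^ t) (1 : R)
      rw [← map_smul]; simp
    rw [preL_preL, h1, preL_smul, preL_id]
    change _ = φ (mu hk (a j) (w 1 j))
    rw [← hc, ← map_smul]
    rfl
  have hF : kil (m ^ t) (Fin r → R ⧸ m ^ t) := kil_pi (kil_quot _)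
  obtain ⟨δ, hL⟩ := exists_LES (LinearMap.ker q).subtype q (Submodule.subtype_injective _) hq
      (LinearMap.exact_subtype_ker_map q)
  have hK : kil (m ^ t) (LinearMap.ker q) := hF.of_inj _ (Submodule.subtype_injective _)
  have h0 : preL (LinearMap.ker q).subtype R n ξ0 = 0 := by
    obtain ⟨r', a', hq'⟩ := exists_fin_quot hK
    have hF' : kil (m ^ t) (Fin r' → R ⧸ m ^ t) := kil_pi (kil_quot _)
    refine L.preL_inj hF' _ hq' _ ?_
    apply pi_preL_ext
    intro j
    rw [preL_preL, preL_preL, key]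
    simp
  obtain ⟨ξ, hξ⟩ := hL.con2 ξ0 h0
  refine ⟨ξ, fun a => ?_⟩
  obtain ⟨v, rfl⟩ := hq a
  have : mu hk (q v) = q ∘ₗ mu hF v := by
    apply hom_quot_ext
    simp [mu_one]
  rw [this, ← preL_preL]
  have h2 : preL q R n ξ = ξ0 := hξ
  rw [h2, key, mu_one]

lemma kil_EX {I : Ideal R} (hk : kil I A) (i : ℕ) : kil I (EX R A B i) := by
  intro r hr x
  rw [← hm_smul_comp]
  have : r • (LinearMap.id : A →ₗ[R] A) = 0 := by
    ext a; exact hk r hr a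
  rw [this, hm_zero, Abelian.Ext.zero_comp]

lemma kil_quot_smul (I : Ideal R) (A : Type) [AddCommGroup A] [Module R A] : 
    kil I (A ⧸ (I • (⊤ : Submodule R A))) := by
  intro r hr a
  obtain ⟨a, rfl⟩ := Submodule.mkQ_surjective _ a
  rw [← map_smul]
  exact (Submodule.Quotient.mk_eq_zero _).mpr (Submodule.smul_mem_smul hr Submodule.mem_top)

lemma LDat.V3 (L : LDat R m n) {t : ℕ} [Module.Finite R A] [Module.Finite R B] (f : A →ₗ[R] B)
    (hf : Function.Injective f) (φ : A →ₗ[R] EX R (R ⧸ m ^ t) R n) : 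
    ∃ (s : ℕ) (h : t ≤ s) (ψ : B →ₗ[R] EX R (R ⧸ m ^ s) R n), 
      ∀ a, ψ (f a) = preL (qm (Ideal.pow_le_pow_right h)) R n (φ a) := by
  obtain ⟨k, hk⟩ := Ideal.exists_pow_inf_eq_pow_smul m (LinearMap.range f)
  have hts : t ≤ t + k := Nat.le_add_right _ _
  let s := t + k
  have hle : m ^ s ≤ m ^ t := Ideal.pow_le_pow_right hts
  let P : Submodule R B := m ^ s • ⊤
  have hAR : ∀ a, f a ∈ P → a ∈ (m ^ t • (⊤ : Submodule R A)) := by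
    intro a ha
    have h1 := hk s (by omega)
    have h2 : f a ∈ m ^ (s - k) • (m ^ k • ⊤ ⊓ LinearMap.range f) := h1 ▸ ⟨ha, ⟨a, rfl⟩⟩
    have h3 : f a ∈ m ^ t • LinearMap.range f := by
      have : s - k = t := by omega
      rw [this] at h2
      exact Submodule.smul_mono le_rfl inf_le_right h2
    rw [LinearMap.range_eq_map, ← Submodule.map_smul''] at h3
    obtain ⟨b, hb, hb'⟩ := h3
    rwa [hf hb'] at hb
  let Q : Submodule R A := P.comap f
  have hB : kil (m ^ s) (B ⧸ P) := kil_quot_smul _ _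
  let fb : (A ⧸ Q) →ₗ[R] (B ⧸ P) := Submodule.mapQ Q P f le_rfl
  have hfb : Function.Injective fb := by
    rw [← LinearMap.ker_eq_bot, Submodule.ker_mapQ]
    exact Submodule.mkQ_map_self Q
  have hA : kil (m ^ s) (A ⧸ Q) := hB.of_inj fb hfb
  let φ' : (A ⧸ Q) →ₗ[R] EX R (R ⧸ m ^ s) R n := Submodule.liftQ Q (preL (qm hle) R n ∘ₗ φ) (by
    intro a ha
    have := hAR a ha
    rw [LinearMap.mem_ker, LinearMap.comp_apply]
    suffices φ a = 0 by rw [this, map_zero]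
    refine Submodule.smul_induction_on this ?_ ?_
    · intro r hr x _
      rw [map_smul]
      exact kil_EX (kil_quot _) n r hr _
    · intro x y hx hy; rw [map_add, hx, hy, add_zero])
  obtain ⟨ξ, hξ⟩ := L.theta_surj hA φ'
  obtain ⟨δ, hL⟩ := exists_LES fb (LinearMap.range fb).mkQ hfb (Submodule.mkQ_surjective _)
      (LinearMap.exact_map_mkQ_range fb)
  have hC : kil (m ^ s) ((B ⧸ P) ⧸ LinearMap.range fb) := hB.of_surj _ (Submodule.mkQ_surjective _)
  obtain ⟨η, hη⟩ := hL.con1 rfl ξ (L.V2 hC (by omega) _)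
  let ψ : B →ₗ[R] EX R (R ⧸ m ^ s) R n := 
    { toFun := fun b => preL (mu hB (P.mkQ b)) R n η
      map_add' := fun x y => by
        rw [← preL_add]; congr 2; apply hom_quot_ext; simp [mu_one]
      map_smul' := fun r x => by
        rw [RingHom.id_apply, ← preL_smul]; congr 2; apply hom_quot_ext; simp [mu_one] }
  refine ⟨s, hts, ψ, fun a => ?_⟩
  change preL (mu hB (P.mkQ (f a))) R n η = _
  have h1 : mu hB (P.mkQ (f a)) = fb ∘ₗ mu hA (Q.mkQ a) := by
    apply hom_quot_ext
    rw [LinearMap.comp_apply, mu_one, mu_one]; rfl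
  have h2 : preL fb R n η = ξ := hη
  rw [h1, ← preL_preL, h2, hξ]
  rfl

end B3

set_option linter.unusedVariables false
set_option linter.unusedSectionVars false

section B4

variable {R : Type} [CommRing R] 
variable {A B C D : Type} [AddCommGroup A] [Module R A] [AddCommGroup B] [Module R B]
  [AddCommGroup C] [Module R C] [AddCommGroup D] [Module R D]

/-- the projection `R/m^s → R/m^t` -/
abbrev pr (m : Ideal R) {t s : ℕ} (h : t ≤ s) : (R ⧸ m ^ s) →ₗ[R] (R ⧸ m ^ t) :=
  qm (Ideal.pow_le_pow_right h)

lemma preL_pr_pr (m : Ideal R) {t s u i : ℕ} (h : t ≤ s) (h' : s ≤ u) (x : EX R (R ⧸ m ^ t) A i) :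
    preL (pr m h') A i (preL (pr m h) A i x) = preL (pr m (h.trans h')) A i x := by
  rw [preL_preL, qm_qm]

/-- composition as linear map in the second variable -/
noncomputable def pairL {i j n : ℕ} (β : EX R A B i) (C : Type) [AddCommGroup C] [Module R C]
    (h : i + j = n) : EX R B C j →ₗ[R] EX R A C n where
  toFun e := β.comp e h
  map_add' x y := Abelian.Ext.comp_add _ _ _ _
  map_smul' r x := Abelian.Ext.comp_smul _ _ _ _

lemma pairL_apply {i j n : ℕ} (β : EX R A B i) (h : i + j = n) (e : EX R B C j) :
    pairL β C h e = β.comp e h := rfl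

variable {m : Ideal R} {n : ℕ} [IsNoetherianRing R]

lemma LDat.V3' (L : LDat R m n) {t : ℕ} [Module.Finite R A] [Module.Finite R B] (f : A →ₗ[R] B)
    (φ : A →ₗ[R] EX R (R ⧸ m ^ t) R n) (hf : ∀ a, f a = 0 → φ a = 0) : 
    ∃ (s : ℕ) (h : t ≤ s) (ψ : B →ₗ[R] EX R (R ⧸ m ^ s) R n), 
      ∀ a, ψ (f a) = preL (pr m h) R n (φ a) := by
  obtain ⟨s, h, ψ, hψ⟩ := L.V3 ((LinearMap.ker f).liftQ f le_rfl)
    (by rw [← LinearMap.ker_eq_bot]; exact Submodule.ker_liftQ_eq_bot _ _ _ le_rfl)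
    ((LinearMap.ker f).liftQ φ (fun a ha => hf a ha))
  exact ⟨s, h, ψ, fun a => hψ ((LinearMap.ker f).mkQ a)⟩

lemma free_rep {r : ℕ} (ψ : EX R (Fin r → R) R 0 →ₗ[R] EX R A R n) :
    ∃ β : EX R A (Fin r → R) n, ∀ e, β.comp e (add_zero n) = ψ e := by
  obtain ⟨β, hβ⟩ := EX_free_mk (fun j => ψ (hm (LinearMap.proj j)))
  refine ⟨β, fun e => ?_⟩
  obtain ⟨f, rfl⟩ := hm_surj e
  have hf : f = ∑ j, f (Pi.single j 1) • (LinearMap.proj j : (Fin r → R) →ₗ[R] R) := by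
    apply LinearMap.pi_ext'
    intro i
    ext
    simp [Pi.single_apply]
  have key : ∀ s : Finset (Fin r), ∀ c : Fin r → R, 
      hm (∑ j ∈ s, c j • (LinearMap.proj j : (Fin r → R) →ₗ[R] R)) = 
        ∑ j ∈ s, c j • hm (LinearMap.proj j) := by
    intro s c
    induction s using Finset.induction_on with
    | empty => simp [hm_zero]
    | insert a s ha ih => rw [Finset.sum_insert ha, Finset.sum_insert ha, hm_add, ih, hm_smul]
  rw [hf, key, ← pairL_apply, map_sum, map_sum]
  refine Finset.sum_congr rfl fun j _ => ?_
  rw [map_smul, map_smul, pairL_apply, hβ]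

lemma EX_finite [Module.Finite R A] [Module.Finite R B] (i : ℕ) : Module.Finite R (EX R A B i) := by
  exact ModuleCat.finite_ext R (ModuleCat.of R A) (ModuleCat.of R B) i

lemma exists_pres (A : Type) [AddCommGroup A] [Module R A] [Module.Finite R A] :
    ∃ (r : ℕ) (p : (Fin r → R) →ₗ[R] A) (δ : EX R A (LinearMap.ker p) 1), 
    Function.Surjective p ∧ LES (LinearMap.ker p).subtype p δ := by
  obtain ⟨r, p, hp⟩ := Module.Finite.exists_fin' R A
  obtain ⟨δ, hL⟩ := exists_LES (LinearMap.ker p).subtype p (Submodule.subtype_injective _) hp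
      (LinearMap.exact_subtype_ker_map p)
  exact ⟨r, p, δ, hp, hL⟩

lemma preL_zero_inj (p : A →ₗ[R] B) (hp : Function.Surjective p) (e : EX R B C 0)
    (h : preL p C 0 e = 0) : e = 0 := by
  obtain ⟨f, rfl⟩ := hm_surj e
  rw [preL_apply, hm_comp, ← hm_zero] at h
  have := hm_inj h
  have : f = 0 := by
    ext b
    obtain ⟨a, rfl⟩ := hp b
    exact LinearMap.congr_fun this a
  rw [this, hm_zero]

def LDinj (m : Ideal R) (n : ℕ) (M : Type) [AddCommGroup M] [Module R M] (i j : ℕ) (h : i + j = n) : Prop :=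
  ∀ (t : ℕ) (α : EX R (R ⧸ m ^ t) M i), (∀ e : EX R M R j, α.comp e h = 0) → 
    ∃ (s : ℕ) (h : t ≤ s), preL (pr m h) M i α = 0

def LDsurj (m : Ideal R) (n : ℕ) (M : Type) [AddCommGroup M] [Module R M] (i j : ℕ) (h : i + j = n) : Prop :=
  ∀ (t : ℕ) (φ : EX R M R j →ₗ[R] EX R (R ⧸ m ^ t) R n), 
    ∃ (s : ℕ) (h' : t ≤ s) (β : EX R (R ⧸ m ^ s) M i), ∀ e, β.comp e h = preL (pr m h') R n (φ e)

lemma LDat.inj0 (L : LDat R m n) (M : Type) [AddCommGroup M] [Module R M] [Module.Finite R M] :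
    LDinj m n M n 0 (add_zero n) := by
  intro t α hα
  obtain ⟨r, p, δ, hp, hL⟩ := exists_pres (R := R) M
  obtain ⟨r1, p1, hp1⟩ := Module.Finite.exists_fin' R (LinearMap.ker p)
  obtain ⟨α0, rfl⟩ := hL.co3 rfl α (L.V2 (kil_quot _) (by omega) _)
  let d := (LinearMap.ker p).subtype ∘ₗ p1
  have : Module.Finite R (EX R (Fin r → R) R 0) := EX_finite 0
  have : Module.Finite R (EX R (Fin r1 → R) R 0) := EX_finite 0
  obtain ⟨s, h, ψ, hψ⟩ := L.V3' (preL d R 0) (pairL α0 R (add_zero n)) (by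
    intro f hf
    rw [← preL_preL] at hf
    have := preL_zero_inj p1 hp1 _ hf
    obtain ⟨e, rfl⟩ := hL.con2 f this
    rw [pairL_apply, ← Abelian.Ext.comp_assoc_of_second_deg_zero]
    exact hα e)
  obtain ⟨β, hβ⟩ := free_rep ψ
  refine ⟨s, h, ?_⟩
  have h1 : preL (pr m h) _ n α0 = β.comp (hm d) (add_zero n) := by
    apply EX_free_ext
    intro j
    rw [← preL_comp, Abelian.Ext.comp_assoc_of_second_deg_zero, hβ]
    exact (hψ (hm (LinearMap.proj j))).symm
  rw [preL_comp, h1, Abelian.Ext.comp_assoc_of_third_deg_zero, hm_comp]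
  have : p ∘ₗ d = 0 := by
    ext x; simp [d]
  rw [this, hm_zero, Abelian.Ext.comp_zero]

lemma LDat.surj0 (L : LDat R m n) (M : Type) [AddCommGroup M] [Module R M] [Module.Finite R M] :
    LDsurj m n M n 0 (add_zero n) := by
  intro t φ
  obtain ⟨r, p, δ, hp, hL⟩ := exists_pres (R := R) M
  have : Module.Finite R (EX R (Fin r → R) R 0) := EX_finite 0
  have : Module.Finite R (EX R M R 0) := EX_finite 0
  obtain ⟨s, h, ψ, hψ⟩ := L.V3' (preL p R 0) φ (by
    intro f hf
    rw [preL_zero_inj p hp f hf, map_zero])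
  obtain ⟨β, hβ⟩ := free_rep ψ
  refine ⟨s, h, β.comp (hm p) (add_zero n), fun e => ?_⟩
  rw [Abelian.Ext.comp_assoc_of_second_deg_zero, hβ]
  exact hψ e

lemma LDat.inj (L : LDat R m n) (j : ℕ) : ∀ (i : ℕ) (h : i + j = n) (M : Type) [AddCommGroup M] [Module R M] 
    [Module.Finite R M], LDinj m n M i j h := by
  induction j with
  | zero =>
    intro i h M _ _ _
    subst h
    exact L.inj0 M
  | succ j ih =>
    intro i h M _ _ _ t α hα
    obtain ⟨r, p, δ, hp, hL⟩ := exists_pres (R := R) M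
    obtain ⟨s, hs, h1⟩ := ih (i + 1) (by omega) (LinearMap.ker p) t (α.comp δ rfl) (by
      intro e
      rw [Abelian.Ext.comp_assoc α δ e rfl (add_comm 1 j) (by omega)]
      exact hα _)
    refine ⟨s, hs, ?_⟩
    rw [preL_comp] at h1
    obtain ⟨y, hy⟩ := hL.co3 rfl _ h1
    rw [← hy, L.V1free (kil_quot _) (by omega) y, Abelian.Ext.zero_comp]

lemma LDat.surj (L : LDat R m n) (j : ℕ) : ∀ (i : ℕ) (h : i + j = n) (M : Type) [AddCommGroup M] [Module R M] 
    [Module.Finite R M], LDsurj m n M i j h := by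
  induction j with
  | zero =>
    intro i h M _ _ _
    subst h
    exact L.surj0 M
  | succ j ih =>
    intro i h M _ _ _ t φ
    obtain ⟨r, p, δ, hp, hL⟩ := exists_pres (R := R) M
    obtain ⟨s, hs, β', hβ'⟩ := ih (i + 1) (by omega) (LinearMap.ker p) t 
      (φ ∘ₗ pairL δ R (add_comm 1 j))
    have h0 : β'.comp (hm (LinearMap.ker p).subtype) (add_zero _) = 0 := by
      by_cases hj : i + 1 < n
      · exact L.V1free (kil_quot _) hj _
      · obtain rfl : j = 0 := by omega
        apply EX_free_ext
        intro l
        rw [Abelian.Ext.zero_comp, Abelian.Ext.comp_assoc_of_third_deg_zero]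
        have h2 : n = i + 1 := by omega
        subst h2
        rw [hβ', LinearMap.comp_apply, pairL_apply, 
          ← Abelian.Ext.comp_assoc δ (hm (LinearMap.ker p).subtype) (hm (LinearMap.proj l)) 
            (add_zero 1) (add_zero 0) rfl, hL.df, Abelian.Ext.zero_comp, map_zero, map_zero]
    obtain ⟨β, rfl⟩ := hL.co1 rfl β' h0
    refine ⟨s, hs, β, fun e => ?_⟩
    obtain ⟨e', rfl⟩ := hL.con3 (add_comm 1 j) e (EX_projective (by omega) _)
    rw [← Abelian.Ext.comp_assoc β δ e' rfl (add_comm 1 j) (by omega), hβ']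
    rfl

/-- Claim S -/
lemma LDat.claimS (L : LDat R m n) {i j : ℕ} (h : i + j = n) (M : Type) [AddCommGroup M] [Module R M] 
    [Module.Finite R M] (ℓ : R) (hℓ : ∀ e : EX R M R j, ℓ • e = 0 → e = 0) (t : ℕ) 
    (α : EX R (R ⧸ m ^ t) M i) : 
    ∃ (s : ℕ) (h : t ≤ s) (β : EX R (R ⧸ m ^ s) M i), preL (pr m h) M i α = ℓ • β := by
  have : Module.Finite R (EX R M R j) := EX_finite j
  obtain ⟨s, hs, ψ, hψ⟩ := L.V3' (ℓ • (LinearMap.id : EX R M R j →ₗ[R] EX R M R j)) 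
    (pairL α R h) (by
      intro e he
      rw [hℓ e he, map_zero])
  obtain ⟨u, hu, β, hβ⟩ := L.surj j i h M s ψ
  obtain ⟨v, hv, h1⟩ := L.inj j i h M u (preL (pr m (hs.trans hu)) M i α - ℓ • β) (by
    intro e
    rw [sub_eq_add_neg, Abelian.Ext.add_comp, Abelian.Ext.neg_comp, Abelian.Ext.smul_comp,
      ← Abelian.Ext.comp_smul, hβ, ← preL_comp, ← preL_pr_pr m hs hu]
    have := hψ e
    rw [LinearMap.smul_apply, LinearMap.id_apply] at this
    rw [this, pairL_apply, add_neg_cancel])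
  refine ⟨v, (hs.trans hu).trans hv, preL (pr m hv) M i β, ?_⟩
  rw [map_sub, sub_eq_zero, preL_pr_pr, map_smul] at h1
  exact h1

end B4

set_option linter.unusedVariables false
set_option linter.unusedSectionVars false

section B5

variable {R : Type} [CommRing R] 

lemma tors_pow {m : Ideal R} {M : Type} [AddCommGroup M] [Module R M]
    (h : ∀ x : M, (∀ r ∈ m, r • x = 0) → x = 0) (v : ℕ) : 
    ∀ x : M, (∀ r ∈ m ^ v, r • x = 0) → x = 0 := by
  induction v with
  | zero => 
    intro x hx
    simpa using hx 1 (by simp)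
  | succ v ih =>
    intro x hx
    apply ih
    intro r hr
    apply h
    intro a ha
    rw [smul_smul]
    apply hx
    rw [pow_succ']
    exact Ideal.mul_mem_mul ha hr

variable {m : Ideal R} {n : ℕ} [IsNoetherianRing R]

lemma LDat.exists_ne (L : LDat R m n) : ∃ u : EX R (R ⧸ m ^ 1) R n, u ≠ 0 := by
  by_contra hcon
  push Not at hcon
  obtain ⟨s, h, h1⟩ := L.inj n 0 (zero_add n) (R ⧸ m ^ 1) 1 (hm LinearMap.id) (by
    intro e
    rw [hcon e, Abelian.Ext.comp_zero])
  rw [preL_apply, hm_comp, ← hm_zero] at h1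
  have h2 := hm_inj h1
  have h3 : (1 : R ⧸ m ^ 1) = 0 := by
    obtain ⟨x, hx⟩ := qm_surj (Ideal.pow_le_pow_right h : m ^ s ≤ m ^ 1) 1
    have := LinearMap.congr_fun h2 x
    rw [← hx]; exact this
  have := L.max.ne_top
  rw [pow_one] at h3
  have : (1 : R) ∈ m := Ideal.Quotient.eq_zero_iff_mem.mp h3
  exact L.max.ne_top ((Ideal.eq_top_iff_one _).mpr this)

lemma LDat.top_not_ass (L : LDat R m n) (M : Type) [AddCommGroup M] [Module R M] 
    [Module.Finite R M] (hM : ∀ x : M, (∀ r ∈ m, r • x = 0) → x = 0) (e0 : EX R M R n)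
    (he : ∀ r ∈ m, r • e0 = 0) : e0 = 0 := by
  by_contra hne
  obtain ⟨u, hu⟩ := L.exists_ne
  have : Module.Finite R (EX R M R n) := EX_finite n
  obtain ⟨s, hs, ψ, hψ⟩ := L.V3' (LinearMap.toSpanSingleton R (EX R M R n) e0) 
    (LinearMap.toSpanSingleton R _ u) (by
      intro r hr
      rw [LinearMap.toSpanSingleton_apply] at hr ⊢
      by_cases hrm : r ∈ m
      · exact kil_EX (kil_quot _) n r (by rwa [pow_one]) u
      · exfalso
        obtain ⟨a, ha⟩ := L.max.exists_inv hrm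
        obtain ⟨b, hb, hab⟩ := ha
        apply hne
        have : (a * r + b) • e0 = 0 := by
          rw [add_smul, mul_smul, hr, he b hb, smul_zero, add_zero]
        rwa [hab, one_smul] at this)
  obtain ⟨v, hv, β, hβ⟩ := L.surj n 0 (zero_add n) M s ψ
  have hβ0 : β = 0 := by
    obtain ⟨b, rfl⟩ := hm_surj β
    have : b = 0 := by
      apply hom_quot_ext
      apply tors_pow hM v
      intro r hr
      rw [← map_smul, kil_quot _ r hr, map_zero]
    rw [this, hm_zero]
  have h1 := hβ e0
  have h2 := hψ 1
  rw [LinearMap.toSpanSingleton_apply, LinearMap.toSpanSingleton_apply, one_smul, one_smul] at h2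
  rw [hβ0, Abelian.Ext.zero_comp, h2, preL_pr_pr] at h1
  exact hu (L.preL_inj (kil_quot (m ^ v)) _ (qm_surj _) _ h1.symm)

end B5

set_option linter.unusedVariables false
set_option linter.unusedSectionVars false

section B6

variable {R : Type} [CommRing R] 

/-- ideals generated by weakly regular sequences of given length -/
inductive RegS (R : Type) [CommRing R] : ℕ → Ideal R → Prop
  | zero : RegS R 0 ⊥
  | succ (i : ℕ) (I : Ideal R) (r : R) : RegS R i I → (∀ y, r * y ∈ I → y ∈ I) → 
      RegS R (i + 1) (I ⊔ Ideal.span {r})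

lemma exists_LES_reg (I : Ideal R) (r : R) (h : ∀ y, r * y ∈ I → y ∈ I) : 
    ∃ δ, LES (r • (LinearMap.id : (R ⧸ I) →ₗ[R] (R ⧸ I))) 
      (qm (le_sup_left : I ≤ I ⊔ Ideal.span {r})) δ := by
  apply exists_LES
  · rw [injective_iff_map_eq_zero]
    intro y hy
    obtain ⟨y, rfl⟩ := Submodule.mkQ_surjective _ y
    rw [LinearMap.smul_apply, LinearMap.id_apply, ← map_smul] at hy
    exact (Submodule.Quotient.mk_eq_zero _).mpr (h y ((Submodule.Quotient.mk_eq_zero _).mp hy))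
  · exact qm_surj _
  · intro y
    obtain ⟨y, rfl⟩ := Submodule.mkQ_surjective _ y
    constructor
    · intro hy
      have hy' : y ∈ I ⊔ Ideal.span {r} := (Submodule.Quotient.mk_eq_zero _).mp hy
      obtain ⟨a, ha, b, hb, rfl⟩ := Submodule.mem_sup.mp hy'
      obtain ⟨c, rfl⟩ := Ideal.mem_span_singleton.mp hb
      refine ⟨I.mkQ c, ?_⟩
      rw [LinearMap.smul_apply, LinearMap.id_apply, ← map_smul, map_add,
        show I.mkQ a = 0 from (Submodule.Quotient.mk_eq_zero _).mpr ha, zero_add, smul_eq_mul]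
    · rintro ⟨z, hz⟩
      obtain ⟨z, rfl⟩ := Submodule.mkQ_surjective _ z
      rw [← hz, LinearMap.smul_apply, LinearMap.id_apply, ← map_smul]
      refine (Submodule.Quotient.mk_eq_zero _).mpr ?_
      exact Ideal.mem_sup_right (Ideal.mem_span_singleton.mpr ⟨z, rfl⟩)

lemma RegS.main [IsNoetherianRing R] {h : ℕ} {I : Ideal R} (hI : RegS R h I) : 
    (∀ i, h < i → ∀ (N : Type) [AddCommGroup N] [Module R N], ∀ e : EX R (R ⧸ I) N i, e = 0) ∧
    (∀ i < h, ∀ e : EX R (R ⧸ I) R i, e = 0) ∧ 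
    ∃ u : EX R (R ⧸ I) R h, (∀ e, ∃ c : R, e = c • u) ∧ (∀ c : R, c • u = 0 → c ∈ I) := by
  induction hI with
  | zero =>
    have e : R ≃ₗ[R] (R ⧸ (⊥ : Ideal R)) := (Submodule.quotEquivOfEqBot ⊥ rfl).symm
    have : Module.Projective R (R ⧸ (⊥ : Ideal R)) := Module.Projective.of_equiv e
    refine ⟨fun i hi N _ _ e => EX_projective hi e, fun i hi => absurd hi (by omega), ?_⟩
    refine ⟨hm ((⊥ : Ideal R).liftQ LinearMap.id bot_le), ?_, ?_⟩
    · intro e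
      obtain ⟨f, rfl⟩ := hm_surj e
      refine ⟨f 1, ?_⟩
      rw [← hm_smul]
      congr 2
      apply hom_quot_ext
      change _ = f 1 • (1 : R)
      simp
    · intro c hc
      rw [← hm_smul, ← hm_zero] at hc
      have : c • (1 : R) = 0 := LinearMap.congr_fun (hm_inj hc) (1 : R ⧸ (⊥ : Ideal R))
      simpa using this
  | succ h I r hI hr ih =>
    obtain ⟨i1, i2, u, hu1, hu2⟩ := ih
    obtain ⟨δ, hL⟩ := exists_LES_reg I r hr
    refine ⟨?_, ?_, ?_⟩
    · intro i hi N _ _ e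
      obtain ⟨i, rfl⟩ : ∃ i', i = 1 + i' := ⟨i - 1, by omega⟩
      obtain ⟨y, rfl⟩ := hL.con3 rfl e (i1 _ (by omega) _ _)
      rw [i1 i (by omega) N y, Abelian.Ext.comp_zero]
    · intro i hi e
      have hg : (hm (qm (le_sup_left : I ≤ I ⊔ Ideal.span {r}))).comp e (zero_add i) = 0 := by
        by_cases hi' : i < h
        · exact i2 i hi' _
        · obtain rfl : i = h := by omega
          obtain ⟨c, hc⟩ := hu1 ((hm (qm (le_sup_left : I ≤ I ⊔ Ideal.span {r}))).comp e (zero_add i))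
          have : r • (hm (qm (le_sup_left : I ≤ I ⊔ Ideal.span {r}))).comp e (zero_add i) = 0 := by
            rw [← hm_smul_comp, hm_comp_assoc, hL.zero_fg, hm_zero, Abelian.Ext.zero_comp]
          rw [hc, smul_smul] at this
          have := hr _ (hu2 _ this)
          rw [hc]
          exact kil_EX (kil_quot _) _ c this _
      cases i with
      | zero => exact preL_zero_inj _ (qm_surj _) e hg
      | succ i => 
        obtain ⟨y, rfl⟩ := hL.con3 (add_comm 1 i) e hg
        rw [i2 i (by omega) y, Abelian.Ext.comp_zero]
    · refine ⟨δ.comp u (add_comm 1 h), fun e => ?_, fun c hc => ?_⟩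
      · obtain ⟨y, rfl⟩ := hL.con3 (add_comm 1 h) e (i1 _ (by omega) _ _)
        obtain ⟨c, rfl⟩ := hu1 y
        exact ⟨c, by rw [Abelian.Ext.comp_smul]⟩
      · rw [← Abelian.Ext.comp_smul] at hc
        obtain ⟨y, hy⟩ := hL.con1 _ _ hc
        obtain ⟨d, rfl⟩ := hu1 y
        rw [hm_smul_comp, smul_smul] at hy
        have : (c - r * d) • u = 0 := by rw [sub_smul, hy, sub_self]
        have := hu2 _ this
        rw [show c = (c - r * d) + r * d by ring]
        exact Ideal.add_mem _ (Ideal.mem_sup_left this) 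
          (Ideal.mem_sup_right (Ideal.mem_span_singleton.mpr ⟨d, rfl⟩))

lemma RegS.lDat [IsNoetherianRing R] {h : ℕ} {I : Ideal R} (hI : RegS R h I) (hmax : I.IsMaximal) : LDat R I h :=
  ⟨hmax, hI.main.2.1, fun i hi N _ _ e => hI.main.1 i hi N e⟩

lemma regS_poly (k : Type) [Field k] (n : ℕ) (i : ℕ) (hi : i ≤ n) : 
    RegS (MvPolynomial (Fin n) k) i 
      (Ideal.span (MvPolynomial.X '' {j : Fin n | j.1 < i})) := by
  induction i with
  | zero => 
    convert RegS.zero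
    simp
  | succ i ih =>
    have h1 := RegS.succ i _ (MvPolynomial.X (⟨i, hi⟩ : Fin n)) (ih (by omega)) (by
      intro y hy
      rw [MvPolynomial.mem_ideal_span_X_image] at hy ⊢
      intro d hd
      obtain ⟨j, hj, hj'⟩ := hy (Finsupp.single ⟨i, hi⟩ 1 + d) (by
        rw [MvPolynomial.mem_support_iff, MvPolynomial.coeff_X_mul]
        exact MvPolynomial.mem_support_iff.mp hd)
      refine ⟨j, hj, ?_⟩
      have : (⟨i, hi⟩ : Fin n) ≠ j := by
        intro h
        have : j.1 < i := hj
        rw [← h] at this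
        simp at this
      simpa [Finsupp.single_apply, this] using hj')
    convert h1
    rw [← Ideal.span_union]
    congr 1
    ext f
    constructor
    · rintro ⟨j, hj, rfl⟩
      have hj' : j.1 < i + 1 := hj
      by_cases h : j.1 < i
      · exact Or.inl ⟨j, h, rfl⟩
      · right
        have : j = ⟨i, hi⟩ := Fin.ext (by simp; omega)
        rw [this]; rfl
    · rintro (⟨j, hj, rfl⟩ | h)
      · exact ⟨j, Nat.lt_succ_of_lt hj, rfl⟩
      · rw [Set.mem_singleton_iff] at h
        exact ⟨⟨i, hi⟩, Nat.lt_succ_self i, h.symm⟩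

lemma irr_max (k : Type) [Field k] (n : ℕ) : (irrIdeal k n).IsMaximal := by
  have : irrIdeal k n = RingHom.ker (MvPolynomial.constantCoeff (σ := Fin n) (R := k)) := by
    ext f
    rw [irrIdeal, ← Set.image_univ, MvPolynomial.mem_ideal_span_X_image, RingHom.mem_ker,
      MvPolynomial.constantCoeff_eq]
    constructor
    · intro h
      by_contra hne
      obtain ⟨j, _, hj⟩ := h 0 (MvPolynomial.mem_support_iff.mpr hne)
      exact hj rfl
    · intro h d hd
      by_contra hcon
      push Not at hcon
      have : d = 0 := by
        ext j; exact hcon j (Set.mem_univ j)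
      rw [this] at hd
      exact (MvPolynomial.mem_support_iff.mp hd) h
  rw [this]
  apply RingHom.ker_isMaximal_of_surjective
  intro x
  exact ⟨MvPolynomial.C x, by simp⟩

lemma lDat_poly (k : Type) [Field k] (n : ℕ) : LDat (MvPolynomial (Fin n) k) (irrIdeal k n) n := by
  apply RegS.lDat _ (irr_max k n)
  have := regS_poly k n n le_rfl
  convert this
  rw [irrIdeal]
  congr 1
  ext f
  simp

end B6

set_option linter.unusedVariables false
set_option linter.unusedSectionVars false

section C1

inductive RegI {R : Type} [CommRing R] (p : Ideal R) : ℕ → Ideal R → Prop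
  | zero : RegI p 0 ⊥
  | succ (i : ℕ) (I : Ideal R) (r : R) : RegI p i I → r ∈ p → 
      (∀ y, r * y ∈ I → ∃ s, s ∉ p ∧ s * y ∈ I) → RegI p (i + 1) (I ⊔ Ideal.span {r})

def PropP (R : Type) [CommRing R] (n : ℕ) : Prop :=
  ∀ p : Ideal R, p.IsPrime → ∃ i ≤ n, ∃ I, RegI p i I ∧ ∀ g ∈ p, ∃ s, s ∉ p ∧ s * g ∈ I

variable {R : Type} [CommRing R]

lemma RegI.le {p : Ideal R} {i : ℕ} {I : Ideal R} (h : RegI p i I) : I ≤ p := by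
  induction h with
  | zero => exact bot_le
  | succ i I r h hr hy ih => 
    exact sup_le ih ((Ideal.span_singleton_le_iff_mem _).mpr hr)

lemma propP_field (k : Type) [Field k] : PropP k 0 := by
  intro p hp
  refine ⟨0, le_rfl, ⊥, .zero, fun g hg => ⟨1, ?_, ?_⟩⟩
  · exact fun h => hp.ne_top ((Ideal.eq_top_iff_one _).mpr h)
  · rcases Ideal.eq_bot_or_top p with h | h
    · rw [h] at hg; simpa using hg
    · exact absurd h hp.ne_top

lemma PropP.equiv {S : Type} [CommRing S] {n : ℕ} (h : PropP R n) (e : R ≃+* S) : PropP S n := by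
  intro p hp
  have mm : ∀ (I : Ideal R) (y : S), y ∈ I.map e ↔ e.symm y ∈ I := by
    intro I y
    rw [Ideal.mem_map_of_equiv]
    constructor
    · rintro ⟨x, hx, rfl⟩; simpa using hx
    · intro h; exact ⟨_, h, by simp⟩
  have key : ∀ i I, RegI (p.comap e) i I → RegI p i (I.map e) := by
    intro i I hI
    induction hI with
    | zero => rw [Ideal.map_bot]; exact .zero
    | succ i I r h hr hy ih =>
      rw [Ideal.map_sup, Ideal.map_span, Set.image_singleton]
      refine .succ i _ _ ih hr ?_
      intro y hry
      rw [mm] at hry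
      have := hy (e.symm y) (by simpa using hry)
      obtain ⟨s, hs, hs'⟩ := this
      refine ⟨e s, hs, ?_⟩
      rw [mm]
      simpa using hs'
  obtain ⟨i, hi, I, hI, hg⟩ := h (p.comap e) (Ideal.comap_isPrime e p)
  refine ⟨i, hi, I.map e, key i I hI, fun g hgp => ?_⟩
  obtain ⟨s, hs, hs'⟩ := hg (e.symm g) (by rw [Ideal.mem_comap]; simpa only [RingEquiv.apply_symm_apply] using hgp)
  refine ⟨e s, hs, ?_⟩
  rw [mm]
  simpa using hs'

open Polynomial in
lemma PropP.poly {n : ℕ} (h : PropP R n) : PropP R[X] (n + 1) := by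
  intro p hp
  have hq : (p.comap C).IsPrime := Ideal.comap_isPrime C p
  set q := p.comap C with hqdef
  have clear : ∀ (I : Ideal R) (y : R[X]), (∀ l, ∃ s, s ∉ q ∧ s * y.coeff l ∈ I) → 
      ∃ s, s ∉ p ∧ s * y ∈ I.map C := by
    intro I y hy
    choose s hs hs' using hy
    refine ⟨C (∏ l ∈ y.support, s l), ?_, ?_⟩
    · intro hmem
      have : ∏ l ∈ y.support, s l ∈ q := hmem
      obtain ⟨l, _, hl⟩ := hq.prod_mem_iff.mp this
      exact hs l hl
    · rw [Ideal.mem_map_C_iff]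
      intro l
      rw [coeff_C_mul]
      by_cases hl : l ∈ y.support
      · obtain ⟨d, hd⟩ := Finset.dvd_prod_of_mem s hl
        rw [hd, mul_comm (s l), mul_assoc]
        exact Ideal.mul_mem_left _ _ (hs' l)
      · rw [notMem_support_iff.mp hl, mul_zero]; exact I.zero_mem
  obtain ⟨i, hi, I, hI, hg⟩ := h q hq
  have key : ∀ i I, RegI q i I → RegI p i (I.map C) := by
    intro i I hI
    induction hI with
    | zero => rw [Ideal.map_bot]; exact .zero
    | succ i I r h hr hy ih =>
      rw [Ideal.map_sup, Ideal.map_span, Set.image_singleton]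
      refine .succ i _ _ ih hr ?_
      intro y hry
      apply clear
      intro l
      apply hy
      rw [Ideal.mem_map_C_iff] at hry
      simpa using hry l
  have clear2 : ∀ y ∈ q.map C, ∃ s, s ∉ p ∧ s * y ∈ I.map C := by
    intro y hy
    apply clear
    intro l
    exact hg _ (Ideal.mem_map_C_iff.mp hy l)
  by_cases hcase : ∀ g ∈ p, g ∈ q.map C
  · exact ⟨i, by omega, I.map C, key i I hI, fun g hg => clear2 g (hcase g hg)⟩
  · push Not at hcase
    classical
    have hex : ∃ d, ∃ f ∈ p, f ∉ q.map C ∧ f.natDegree = d := by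
      obtain ⟨g, hg, hg'⟩ := hcase
      exact ⟨_, g, hg, hg', rfl⟩
    obtain ⟨f, hfp, hfq, hfd⟩ := Nat.find_spec hex
    set d := Nat.find hex with hd
    have hmin : ∀ g ∈ p, g.natDegree < d → g ∈ q.map C := by
      intro g hg hgd
      by_contra hcon
      exact Nat.find_min hex hgd ⟨g, hg, hcon, rfl⟩
    have hCq : ∀ c ∈ q, (C c : R[X]) ∈ q.map C := fun c hc => Ideal.mem_map_of_mem C hc
    have hqp : q.map C ≤ p := Ideal.map_comap_le
    have hd0 : 0 < d := by
      by_contra hcon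
      have : f.natDegree = 0 := by omega
      rw [natDegree_eq_zero] at this
      obtain ⟨c, rfl⟩ := this
      exact hfq (hCq c hfp)
    have ha : f.leadingCoeff ∉ q := by
      intro ha
      have h1 : C f.leadingCoeff * X ^ f.natDegree ∈ q.map C := Ideal.mul_mem_right _ _ (hCq _ ha)
      have h2 : f.eraseLead = f - C f.leadingCoeff * X ^ f.natDegree := 
        (self_sub_C_mul_X_pow f).symm
      have h3 : f.eraseLead ∈ q.map C := by
        apply hmin
        · rw [h2]; exact Ideal.sub_mem _ hfp (hqp h1)
        · have := eraseLead_natDegree_le f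
          omega
      apply hfq
      have := Ideal.add_mem _ h3 h1
      rwa [h2, sub_add_cancel] at this
    have hprime : (q.map C).IsPrime := Ideal.isPrime_map_C_of_isPrime
    have hIq : I.map C ≤ q.map C := Ideal.map_mono hI.le
    refine ⟨i + 1, by omega, I.map C ⊔ Ideal.span {f}, .succ i _ f (key i I hI) hfp ?_, ?_⟩
    · intro y hy
      exact clear2 y ((hprime.mem_or_mem (hIq hy)).resolve_left hfq)
    · have main : ∀ N : ℕ, ∀ g ∈ p, g.natDegree ≤ N → ∃ s, s ∉ p ∧ s * g ∈ I.map C ⊔ Ideal.span {f} := by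
        intro N
        induction N with
        | zero =>
          intro g hg hgN
          obtain ⟨s, hs, hs'⟩ := clear2 g (hmin g hg (by omega))
          exact ⟨s, hs, Ideal.mem_sup_left hs'⟩
        | succ N ih =>
          intro g hg hgN
          by_cases hlt : g.natDegree < d
          · obtain ⟨s, hs, hs'⟩ := clear2 g (hmin g hg hlt)
            exact ⟨s, hs, Ideal.mem_sup_left hs'⟩
          by_cases hgN' : g.natDegree ≤ N
          · exact ih g hg hgN'
          have hgN2 : g.natDegree = N + 1 := by omega
          have hle : d ≤ N + 1 := by omega
          obtain ⟨s, hs, hs'⟩ := ih (C f.leadingCoeff * g - C g.leadingCoeff * (X ^ (N + 1 - d) * f))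
            (Ideal.sub_mem _ (Ideal.mul_mem_left _ _ hg) 
              (Ideal.mul_mem_left _ _ (Ideal.mul_mem_left _ _ hfp))) (by
              rw [natDegree_le_iff_coeff_eq_zero]
              intro M hM
              rw [coeff_sub, coeff_C_mul, coeff_C_mul, coeff_X_pow_mul', if_pos (by omega)]
              by_cases hM' : M = N + 1
              · subst hM'
                rw [show N + 1 - (N + 1 - d) = d by omega, ← hfd, ← hgN2, coeff_natDegree,
                  coeff_natDegree, mul_comm, sub_self]
              · rw [coeff_eq_zero_of_natDegree_lt (by omega : g.natDegree < M), 
                  coeff_eq_zero_of_natDegree_lt (by omega : f.natDegree < M - (N + 1 - d))]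
                simp)
          refine ⟨s * C f.leadingCoeff, fun hmem => (hp.mem_or_mem hmem).elim hs ha, ?_⟩
          have h5 : s * C f.leadingCoeff * g = 
            s * (C f.leadingCoeff * g - C g.leadingCoeff * (X ^ (N + 1 - d) * f)) + 
              (s * C g.leadingCoeff * X ^ (N + 1 - d)) * f := by ring
          rw [h5]
          exact Ideal.add_mem _ hs' (Ideal.mul_mem_left _ _ 
            (Ideal.mem_sup_right (Ideal.mem_span_singleton_self f)))
      intro g hg
      exact main _ g hg le_rfl

lemma propP_mv (k : Type) [Field k] (n : ℕ) : PropP (MvPolynomial (Fin n) k) n := by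
  induction n with
  | zero => exact (propP_field k).equiv (MvPolynomial.isEmptyRingEquiv k (Fin 0)).symm
  | succ n ih => exact ih.poly.equiv (MvPolynomial.finSuccEquiv k n).symm.toRingEquiv

lemma RegI.loc {p : Ideal R} [hp : p.IsPrime] {i : ℕ} {I : Ideal R} (h : RegI p i I) :
    RegS (Localization.AtPrime p) i (I.map (algebraMap R (Localization.AtPrime p))) := by
  induction h with
  | zero => rw [Ideal.map_bot]; exact .zero
  | succ i I r h hr hy ih =>
    rw [Ideal.map_sup, Ideal.map_span, Set.image_singleton]
    refine .succ i _ _ ih ?_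
    intro y hy'
    obtain ⟨y, s, rfl⟩ := IsLocalization.exists_mk'_eq p.primeCompl y
    rw [← IsLocalization.mk'_one (M := p.primeCompl) (Localization.AtPrime p) r, ← IsLocalization.mk'_mul,
      IsLocalization.mk'_mem_map_algebraMap_iff] at hy'
    rw [IsLocalization.mk'_mem_map_algebraMap_iff]
    obtain ⟨u, hu, hu'⟩ := hy'
    obtain ⟨v, hv, hv'⟩ := hy (u * y) (by rwa [mul_left_comm])
    exact ⟨v * u, p.primeCompl.mul_mem hv hu, by rwa [mul_assoc]⟩

lemma PropP.lDat [IsNoetherianRing R] {n : ℕ} (h : PropP R n) (p : Ideal R) [hp : p.IsPrime] :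
    ∃ i ≤ n, LDat (Localization.AtPrime p) (IsLocalRing.maximalIdeal (Localization.AtPrime p)) i := by
  obtain ⟨i, hi, I, hI, hg⟩ := h p hp
  have hN : IsNoetherianRing (Localization.AtPrime p) := 
    IsLocalization.isNoetherianRing p.primeCompl _ inferInstance
  have h1 : I.map (algebraMap R (Localization.AtPrime p)) = 
      IsLocalRing.maximalIdeal (Localization.AtPrime p) := by
    rw [← Localization.AtPrime.map_eq_maximalIdeal]
    apply le_antisymm (Ideal.map_mono hI.le)
    rw [Ideal.map_le_iff_le_comap]
    intro g hgp
    obtain ⟨s, hs, hs'⟩ := hg g hgp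
    rw [Ideal.mem_comap, IsLocalization.algebraMap_mem_map_algebraMap_iff p.primeCompl]
    exact ⟨s, hs, hs'⟩
  refine ⟨i, hi, ?_⟩
  have := hI.loc
  rw [h1] at this
  exact this.lDat inferInstance

end C1

set_option linter.unusedVariables false
set_option linter.unusedSectionVars false

section D1

variable {R : Type} [CommRing R] [IsNoetherianRing R] (W : Submonoid R)

lemma loc_hom_lift {M : Type} [AddCommGroup M] [Module R M] [Module.Finite R M]
    (f' : LocalizedModule W M →ₗ[Localization W] Localization W) : 
    ∃ (s : W) (f : M →ₗ[R] R), ∀ x, algebraMap R (Localization W) s * f' (LocalizedModule.mkLinearMap W M x) = 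
      algebraMap R (Localization W) (f x) := by
  have : Module.FinitePresentation R M := Module.finitePresentation_of_finite R M
  obtain ⟨f, s, h⟩ := Module.FinitePresentation.exists_lift_of_isLocalizedModule W 
    (Algebra.linearMap R (Localization W)) 
    ((f'.restrictScalars R) ∘ₗ LocalizedModule.mkLinearMap W M)
  refine ⟨s, f, fun x => ?_⟩
  have := LinearMap.congr_fun h x
  rw [LinearMap.comp_apply, Algebra.linearMap_apply] at this
  rw [this, ← Algebra.smul_def]
  rfl

lemma loc_hom_ext {M N : Type} [AddCommGroup M] [Module R M] [AddCommGroup N] [Module (Localization W) N]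
    (f g : LocalizedModule W M →ₗ[Localization W] N)
    (h : ∀ x, f (LocalizedModule.mkLinearMap W M x) = g (LocalizedModule.mkLinearMap W M x)) : f = g := by
  ext y
  obtain ⟨⟨x, s⟩, hx⟩ := IsLocalizedModule.surj W (LocalizedModule.mkLinearMap W M) y
  have hu : IsUnit (algebraMap R (Localization W) s) := IsLocalization.map_units _ s
  have hx' : algebraMap R (Localization W) s • y = LocalizedModule.mkLinearMap W M x := by
    rw [algebraMap_smul]; exact hx
  have := h x
  rw [← hx', map_smul, map_smul] at this
  exact hu.smul_left_cancel.mp this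

lemma loc_hom_zero {M : Type} [AddCommGroup M] [Module R M] [Module.Finite R M] (f : M →ₗ[R] R)
    (h : ∀ x, algebraMap R (Localization W) (f x) = 0) : ∃ s : W, (s : R) • f = 0 := by
  obtain ⟨s, hs⟩ := Module.Finite.exists_smul_of_comp_eq_of_isLocalizedModule W 
    (Algebra.linearMap R (Localization W)) f 0 (by ext x; simpa using h x)
  exact ⟨s, by rw [smul_zero] at hs; exact hs⟩

lemma loc_map_mk {M N : Type} [AddCommGroup M] [Module R M] [AddCommGroup N] [Module R N] (f : M →ₗ[R] N)
    (x : M) : LocalizedModule.map W f (LocalizedModule.mkLinearMap W M x) = 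
      LocalizedModule.mkLinearMap W N (f x) := by
  simp [LocalizedModule.map_mk]

lemma loc_exact {M N P : Type} [AddCommGroup M] [Module R M] [AddCommGroup N] [Module R N]
    [AddCommGroup P] [Module R P] (f : M →ₗ[R] N) (g : N →ₗ[R] P) (h : Function.Exact f g) :
    Function.Exact (LocalizedModule.map W f) (LocalizedModule.map W g) := by
  intro x
  exact LocalizedModule.map_exact W f g h x

lemma loc_LES {M N P : Type} [AddCommGroup M] [Module R M] [AddCommGroup N] [Module R N]
    [AddCommGroup P] [Module R P] (f : M →ₗ[R] N) (g : N →ₗ[R] P) (hf : Function.Injective f)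
    (hg : Function.Surjective g) (h : Function.Exact f g) :
    ∃ δ, LES (LocalizedModule.map W f : LocalizedModule W M →ₗ[Localization W] LocalizedModule W N)
      (LocalizedModule.map W g : LocalizedModule W N →ₗ[Localization W] LocalizedModule W P) δ := by
  apply exists_LES
  · exact LocalizedModule.map_injective W f hf
  · exact LocalizedModule.map_surjective W g hg
  · exact loc_exact W f g h

lemma locreg0 (ℓ : R) (M : Type) [AddCommGroup M] [Module R M] [Module.Finite R M]
    (hM : ∀ e : EX R M R 0, ℓ • e = 0 → e = 0) 
    (e : EX (Localization W) (LocalizedModule W M) (Localization W) 0)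
    (he : algebraMap R (Localization W) ℓ • e = 0) : e = 0 := by
  obtain ⟨f', rfl⟩ := hm_surj e
  rw [← hm_smul, ← hm_zero] at he
  have h1 := hm_inj he
  obtain ⟨s, f, hf⟩ := loc_hom_lift W f'
  have hu : IsUnit (algebraMap R (Localization W) s) := IsLocalization.map_units _ s
  obtain ⟨u, hu2⟩ := loc_hom_zero W (ℓ • f) (by
    intro x
    rw [LinearMap.smul_apply, smul_eq_mul, map_mul, ← hf, mul_left_comm]
    have := LinearMap.congr_fun h1 (LocalizedModule.mkLinearMap W M x)
    rw [LinearMap.smul_apply, smul_eq_mul, LinearMap.zero_apply] at this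
    rw [this, mul_zero])
  have h3 : hm ((u : R) • f) = 0 := by
    apply hM
    rw [← hm_smul, smul_comm, hu2, hm_zero]
  rw [← hm_zero] at h3
  have h4 := hm_inj h3
  have hu' : IsUnit (algebraMap R (Localization W) u) := IsLocalization.map_units _ u
  have : f' = 0 := by
    apply loc_hom_ext
    intro x
    rw [LinearMap.zero_apply]
    apply (hu'.mul hu).mul_left_cancel
    rw [mul_assoc, hf, mul_zero, ← map_mul]
    have := LinearMap.congr_fun h4 x
    rw [LinearMap.smul_apply, smul_eq_mul] at this
    rw [this]; simp
  rw [this, hm_zero]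

lemma locreg1 (ℓ : R) (M : Type) [AddCommGroup M] [Module R M] [Module.Finite R M]
    (hM : ∀ e : EX R M R 1, ℓ • e = 0 → e = 0) 
    (e : EX (Localization W) (LocalizedModule W M) (Localization W) 1)
    (he : algebraMap R (Localization W) ℓ • e = 0) : e = 0 := by
  obtain ⟨r, p, δ, hp, hL⟩ := exists_pres (R := R) M
  let K := LinearMap.ker p
  let ι := K.subtype
  obtain ⟨δ', hL'⟩ := loc_LES W (LinearMap.ker p).subtype p (Submodule.subtype_injective _) hp
        (LinearMap.exact_subtype_ker_map p)
  obtain ⟨y, rfl⟩ := hL'.con3 (add_zero 1) e (EX_projective one_pos _)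
  rw [← Abelian.Ext.comp_smul] at he
  obtain ⟨f0, hf0⟩ := hL'.con1 _ _ he
  obtain ⟨y', rfl⟩ := hm_surj y
  obtain ⟨f', rfl⟩ := hm_surj f0
  rw [hm_comp, ← hm_smul] at hf0
  have h1 := hm_inj hf0
  obtain ⟨s, y, hy⟩ := loc_hom_lift W y'
  obtain ⟨t, f, hf⟩ := loc_hom_lift W f'
  obtain ⟨u, hu⟩ := loc_hom_zero W ((s : R) • (f ∘ₗ ι) - ℓ • (t : R) • y) (by
    intro x
    rw [LinearMap.sub_apply, LinearMap.smul_apply, LinearMap.smul_apply, LinearMap.smul_apply,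
      map_sub, smul_eq_mul, smul_eq_mul, smul_eq_mul, map_mul, map_mul, map_mul, LinearMap.comp_apply,
      ← hf, ← hy, ← loc_map_mk]
    have := LinearMap.congr_fun h1 (LocalizedModule.mkLinearMap W _ x)
    rw [LinearMap.comp_apply, LinearMap.smul_apply, smul_eq_mul] at this
    rw [this]
    ring)
  have h2 : ℓ • hm ((u : R) • (t : R) • y) = hm (((u : R) • (s : R) • f) ∘ₗ ι) := by
    rw [← hm_smul]
    congr 2
    rw [smul_sub, sub_eq_zero] at hu
    rw [LinearMap.smul_comp, LinearMap.smul_comp, hu, smul_comm]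
  have h3 : δ.comp (hm ((u : R) • (t : R) • y)) (add_zero 1) = 0 := by
    apply hM
    rw [← Abelian.Ext.comp_smul, h2, ← hm_comp, 
      ← Abelian.Ext.comp_assoc δ (hm ι) (hm _) (add_zero 1) (add_zero 0) rfl, hL.df, Abelian.Ext.zero_comp]
  obtain ⟨g0, hg0⟩ := hL.con1 _ _ h3
  obtain ⟨g, rfl⟩ := hm_surj g0
  rw [hm_comp] at hg0
  have h4 := hm_inj hg0
  let g' : LocalizedModule W (Fin r → R) →ₗ[Localization W] Localization W := 
    (LocalizedModule.map W g)
  have hg' : ∀ x, g' (LocalizedModule.mkLinearMap W _ x) = algebraMap R (Localization W) (g x) := by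
    intro x
    exact loc_map_mk W g x
  let c := algebraMap R (Localization W) u * algebraMap R (Localization W) t * 
    algebraMap R (Localization W) s
  have hc : IsUnit c := ((IsLocalization.map_units _ u).mul (IsLocalization.map_units _ t)).mul
    (IsLocalization.map_units _ s)
  have h5 : c • y' = g' ∘ₗ LocalizedModule.map W ι := by
    apply loc_hom_ext
    intro x
    rw [LinearMap.comp_apply, loc_map_mk, hg', LinearMap.smul_apply, smul_eq_mul]
    have := LinearMap.congr_fun h4 x
    rw [LinearMap.comp_apply] at this
    rw [this, LinearMap.smul_apply, LinearMap.smul_apply, smul_eq_mul, smul_eq_mul, map_mul, map_mul,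
      ← hy]
    simp only [c]; ring
  have h6 : c • δ'.comp (hm y') (add_zero 1) = 0 := by
    rw [← Abelian.Ext.comp_smul, ← hm_smul, h5, ← hm_comp, 
      ← Abelian.Ext.comp_assoc δ' (hm _) (hm _) (add_zero 1) (add_zero 0) rfl, hL'.df, 
      Abelian.Ext.zero_comp]
  exact (hc.smul_eq_zero).mp h6

lemma locreg (ℓ : R) (h : ℕ) : ∀ (M : Type) [AddCommGroup M] [Module R M] [Module.Finite R M]
    (hM : ∀ e : EX R M R h, ℓ • e = 0 → e = 0) 
    (e : EX (Localization W) (LocalizedModule W M) (Localization W) h)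
    (he : algebraMap R (Localization W) ℓ • e = 0), e = 0 := by
  induction h with
  | zero => intro M _ _ _ hM e he; exact locreg0 W ℓ M hM e he
  | succ h ih =>
    intro M _ _ _ hM e he
    cases h with
    | zero => exact locreg1 W ℓ M hM e he
    | succ h =>
      obtain ⟨r, p, δ, hp, hL⟩ := exists_pres (R := R) M
      obtain ⟨δ', hL'⟩ := loc_LES W (LinearMap.ker p).subtype p (Submodule.subtype_injective _) hp
        (LinearMap.exact_subtype_ker_map p)
      obtain ⟨y, rfl⟩ := hL'.con3 (add_comm 1 (h + 1)) e (EX_projective (by omega) _)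
      rw [← Abelian.Ext.comp_smul] at he
      obtain ⟨f, hf⟩ := hL'.con1 _ _ he
      rw [EX_projective (by omega) f, Abelian.Ext.comp_zero] at hf
      rw [ih (LinearMap.ker p) ?_ y hf.symm, Abelian.Ext.comp_zero]
      intro z hz
      have : δ.comp z (add_comm 1 (h + 1)) = 0 := by
        apply hM
        rw [← Abelian.Ext.comp_smul, hz, Abelian.Ext.comp_zero]
      obtain ⟨f, hf⟩ := hL.con1 _ _ this
      rw [EX_projective (by omega) f, Abelian.Ext.comp_zero] at hf
      exact hf.symm

end D1

set_option linter.unusedVariables false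
set_option linter.unusedSectionVars false

section E1

def muE {R : Type} [CommRing R] {I : Ideal R} {M : Type} [AddCommGroup M] [Module R M]
    (x : M) (hx : ∀ r ∈ I, r • x = 0) : (R ⧸ I) →ₗ[R] M :=
  Submodule.liftQ I (LinearMap.toSpanSingleton R M x) (fun r hr => hx r hr)

lemma muE_one {R : Type} [CommRing R] {I : Ideal R} {M : Type} [AddCommGroup M] [Module R M]
    (x : M) (hx : ∀ r ∈ I, r • x = 0) : muE x hx 1 = x := by
  change (1 : R) • x = x
  exact one_smul _ _

lemma hom_zero_of_depth {R : Type} [CommRing R] (I : Ideal R) (M : Type) [AddCommGroup M] [Module R M]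
    (h : 0 < mDepth R I M) (x : M) (hx : ∀ r ∈ I, r • x = 0) : x = 0 := by
  have h1 : ¬ Nontrivial (extC R 0 (R ⧸ I) M) := by
    intro hn
    have : mDepth R I M ≤ 0 := sInf_le ⟨0, by simp, hn⟩
    exact absurd h (not_lt.mpr this)
  rw [not_nontrivial_iff_subsingleton] at h1
  have h2 : Subsingleton (EX R (R ⧸ I) M 0) := (bridge R 0 (R ⧸ I) M).symm.toEquiv.subsingleton
  have h3 := hm_inj (Subsingleton.elim (hm (muE x hx)) (hm 0))
  rw [← muE_one x hx, h3]; rfl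

lemma reg_of_ass {R : Type} [CommRing R] [IsNoetherianRing R] (I : Ideal R) (ℓ : R)
    (M : Type) [AddCommGroup M] [Module R M]
    (h : ∀ p ∈ associatedPrimes R M, p ≠ I → ℓ ∉ p)
    (h2 : ∀ x : M, (∀ r ∈ I, r • x = 0) → x = 0) (x : M) (hx : ℓ • x = 0) : x = 0 := by
  by_contra hne
  have : ℓ ∈ ⋃ p ∈ associatedPrimes R M, (p : Set R) := by
    rw [biUnion_associatedPrimes_eq_zero_divisors]
    exact ⟨x, hne, hx⟩
  simp only [Set.mem_iUnion] at this
  obtain ⟨p, hp, hl⟩ := this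
  by_cases hpI : p = I
  · subst hpI
    rw [AssociatedPrimes.mem_iff, isAssociatedPrime_iff] at hp
    obtain ⟨hpr, y, hy⟩ := hp
    have hy0 : y = 0 := by
      apply h2
      intro r hr
      rw [hy, Submodule.mem_colon_singleton, Submodule.mem_bot] at hr
      exact hr
    apply hpr.ne_top
    rw [hy, hy0, Ideal.eq_top_iff_one, Submodule.mem_colon_singleton]
    simp
  · exact h p hp hpI hl

lemma regE (k : Type) [Field k] (n : ℕ)
    (M : Type) [AddCommGroup M] [Module (MvPolynomial (Fin n) k) M] [Module.Finite (MvPolynomial (Fin n) k) M]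
    (hdepth : 0 < mDepth (MvPolynomial (Fin n) k) (irrIdeal k n) M)
    (hEdepth : 0 < eDepth k n M)
    (ℓ : MvPolynomial (Fin n) k) (hsfr : IsSFRg k n ℓ M) (j : ℕ) (hj : j ≤ n) 
    (y : extC (MvPolynomial (Fin n) k) j M (MvPolynomial (Fin n) k)) (hy : ℓ • y = 0) : y = 0 := by
  refine reg_of_ass (irrIdeal k n) ℓ _ (hsfr.2.2 j) ?_ y hy
  intro x hx
  rcases hj.lt_or_eq with hj | rfl
  · apply hom_zero_of_depth _ _ _ x hx
    have h1 : 0 < sSup {r : ℕ∞ | ∃ m : ℕ, r = (m : ℕ∞) ∧ satE k n M m} :=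
      lt_of_lt_of_le hEdepth (min_le_right _ _)
    obtain ⟨_, ⟨m, rfl, hm⟩, h0⟩ := lt_sSup_iff.mp h1
    refine lt_of_lt_of_le ?_ (hm j)
    refine lt_min h0 ?_
    exact tsub_pos_of_lt (by exact_mod_cast hj)
  · have := (lDat_poly k j).top_not_ass M (hom_zero_of_depth _ _ hdepth) (bridge _ j M _ x) (by
      intro r hr
      rw [← map_smul, hx r hr, map_zero])
    exact (LinearEquiv.map_eq_zero_iff _).mp this

lemma regEX (k : Type) [Field k] (n : ℕ)
    (M : Type) [AddCommGroup M] [Module (MvPolynomial (Fin n) k) M] [Module.Finite (MvPolynomial (Fin n) k) M]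
    (hdepth : 0 < mDepth (MvPolynomial (Fin n) k) (irrIdeal k n) M)
    (hEdepth : 0 < eDepth k n M)
    (ℓ : MvPolynomial (Fin n) k) (hsfr : IsSFRg k n ℓ M) (j : ℕ) (hj : j ≤ n) 
    (y : EX (MvPolynomial (Fin n) k) M (MvPolynomial (Fin n) k) j) (hy : ℓ • y = 0) : y = 0 := by
  have := regE k n M hdepth hEdepth ℓ hsfr j hj ((bridge _ j M _).symm y) (by
    rw [← map_smul, hy, map_zero])
  exact (LinearEquiv.map_eq_zero_iff _).mp this

/-- elements killed by a power of the ideal -/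
def gam {R : Type} [CommRing R] (m : Ideal R) (N : Type) [AddCommGroup N] [Module R N] : 
    Submodule R N where
  carrier := {y | ∃ t, ∀ r ∈ m ^ t, r • y = 0}
  zero_mem' := ⟨0, by simp⟩
  add_mem' := by
    rintro a b ⟨t, ht⟩ ⟨s, hs⟩
    refine ⟨t + s, fun r hr => ?_⟩
    rw [smul_add, ht r (Ideal.pow_le_pow_right (by omega) hr), 
      hs r (Ideal.pow_le_pow_right (by omega) hr), add_zero]
  smul_mem' := by
    rintro c x ⟨t, ht⟩
    refine ⟨t, fun r hr => ?_⟩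
    rw [smul_comm, ht r hr, smul_zero]

lemma gam_zero {S : Type} [CommRing S] [IsNoetherianRing S] [IsLocalRing S] (h : ℕ) 
    (L : LDat S (IsLocalRing.maximalIdeal S) h) (N : Type) [AddCommGroup N] [Module S N] 
    [Module.Finite S N] (ℓ : S) (hl : ℓ ∈ IsLocalRing.maximalIdeal S)
    (hr : ∀ e : EX S N S h, ℓ • e = 0 → e = 0) (x : N) 
    (hx : ∀ r ∈ IsLocalRing.maximalIdeal S, r • x = 0) : x = 0 := by
  have h0 : gam (IsLocalRing.maximalIdeal S) N = ⊥ := by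
    apply Submodule.eq_bot_of_le_smul_of_le_jacobson_bot (Ideal.span {ℓ}) _ 
      (IsNoetherian.noetherian _)
    · rintro y ⟨t, ht⟩
      obtain ⟨s, hs, β, hβ⟩ := L.claimS (zero_add h) N ℓ hr t (hm (muE y ht))
      obtain ⟨b, rfl⟩ := hm_surj β
      rw [preL_apply, hm_comp, ← hm_smul] at hβ
      have h1 := LinearMap.congr_fun (hm_inj hβ) 1
      have h2 : muE y ht 1 = ℓ • b 1 := h1
      rw [muE_one] at h2
      rw [h2]
      apply Submodule.smul_mem_smul (Ideal.mem_span_singleton_self ℓ)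
      refine ⟨s, fun r hr => ?_⟩
      rw [← map_smul]
      have : r • (1 : S ⧸ IsLocalRing.maximalIdeal S ^ s) = 0 := kil_quot _ r hr 1
      rw [this, map_zero]
    · rw [Ideal.span_singleton_le_iff_mem, IsLocalRing.jacobson_eq_maximalIdeal _ bot_ne_top]
      exact hl
  have : x ∈ gam (IsLocalRing.maximalIdeal S) N := ⟨1, by simpa using hx⟩
  rw [h0] at this
  simpa using this

lemma regM (k : Type) [Field k] (n : ℕ)
    (M : Type) [AddCommGroup M] [Module (MvPolynomial (Fin n) k) M] [Module.Finite (MvPolynomial (Fin n) k) M]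
    (ℓ : MvPolynomial (Fin n) k) 
    (hreg : ∀ j ≤ n, ∀ y : EX (MvPolynomial (Fin n) k) M (MvPolynomial (Fin n) k) j, ℓ • y = 0 → y = 0) 
    (x : M) (hx : ℓ • x = 0) : x = 0 := by
  by_contra hne
  have : ℓ ∈ ⋃ p ∈ associatedPrimes (MvPolynomial (Fin n) k) M, (p : Set _) := by
    rw [biUnion_associatedPrimes_eq_zero_divisors]
    exact ⟨x, hne, hx⟩
  simp only [Set.mem_iUnion] at this
  obtain ⟨p, hp, hl⟩ := this
  rw [AssociatedPrimes.mem_iff, isAssociatedPrime_iff] at hp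
  obtain ⟨hpr, y, hy⟩ := hp
  obtain ⟨h, hn, L⟩ := (propP_mv k n).lDat p
  have hN : IsNoetherianRing (Localization.AtPrime p) := 
    IsLocalization.isNoetherianRing p.primeCompl _ inferInstance
  have key := gam_zero h L (LocalizedModule p.primeCompl M) (algebraMap _ (Localization.AtPrime p) ℓ)
    (by
      rw [← Localization.AtPrime.map_eq_maximalIdeal]
      exact Ideal.mem_map_of_mem _ hl)
    (locreg p.primeCompl ℓ h M (hreg h hn))
    (LocalizedModule.mkLinearMap p.primeCompl M y) (by
      intro r hr
      rw [← Localization.AtPrime.map_eq_maximalIdeal] at hr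
      have : Ideal.map (algebraMap _ (Localization.AtPrime p)) p ≤ 
        (⊥ : Submodule (Localization.AtPrime p) _).colon {(LocalizedModule.mkLinearMap p.primeCompl M y)} := by
        rw [Ideal.map_le_iff_le_comap]
        intro a ha
        rw [Ideal.mem_comap, Submodule.mem_colon_singleton, Submodule.mem_bot, algebraMap_smul, ← map_smul]
        rw [hy, Submodule.mem_colon_singleton, Submodule.mem_bot] at ha
        rw [ha, map_zero]
      have := this hr
      rwa [Submodule.mem_colon_singleton, Submodule.mem_bot] at this)
  rw [IsLocalizedModule.eq_zero_iff p.primeCompl] at key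
  obtain ⟨s, hs⟩ := key
  apply s.2
  have h9 : (s : MvPolynomial (Fin n) k) ∈ (⊥ : Submodule _ M).colon {y} := by
    rw [Submodule.mem_colon_singleton, Submodule.mem_bot]
    exact hs
  exact hy.symm.le h9

end E1

set_option linter.unusedVariables false
set_option linter.unusedSectionVars false

section G1

variable {R : Type} [CommRing R] {A B C D : Type} [AddCommGroup A] [Module R A] [AddCommGroup B] [Module R B]
  [AddCommGroup C] [Module R C] [AddCommGroup D] [Module R D]

lemma exists_LES_ell (M : Type) [AddCommGroup M] [Module R M] (ℓ : R) 
    (hℓ : ∀ x : M, ℓ • x = 0 → x = 0) :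
    ∃ δ, LES (ℓ • (LinearMap.id : M →ₗ[R] M)) 
      (Submodule.mkQ (Ideal.span {ℓ} • (⊤ : Submodule R M))) δ := by
  apply exists_LES
  · rw [injective_iff_map_eq_zero]
    exact hℓ
  · exact Submodule.mkQ_surjective _
  · rw [LinearMap.exact_iff, Submodule.ker_mkQ, Submodule.ideal_span_singleton_smul]
    ext x
    rw [Submodule.mem_smul_pointwise_iff_exists, LinearMap.mem_range]
    simp

/-- composition with a fixed class on the left -/
noncomputable def compL {p : ℕ} (δ : EX R C A p) (X : Type) [AddCommGroup X] [Module R X] {n m : ℕ} 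
    (h : p + n = m) : EX R A X n →ₗ[R] EX R C X m where
  toFun x := δ.comp x h
  map_add' x y := Abelian.Ext.comp_add _ _ _ _
  map_smul' r x := Abelian.Ext.comp_smul _ _ _ _

/-- composition with a fixed class on the right -/
noncomputable def compR {p : ℕ} (X : Type) [AddCommGroup X] [Module R X] (δ : EX R C A p) {n m : ℕ} 
    (h : n + p = m) : EX R X C n →ₗ[R] EX R X A m where
  toFun x := x.comp δ h
  map_add' x y := Abelian.Ext.add_comp _ _ _ _
  map_smul' r x := Abelian.Ext.smul_comp _ _ _ _

lemma part1 (M : Type) [AddCommGroup M] [Module R M] (ℓ : R) 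
    (hℓ : ∀ x : M, ℓ • x = 0 → x = 0) (i : ℕ) 
    (h2 : ∀ e : EX R M R (i + 1), ℓ • e = 0 → e = 0) :
    Nonempty ((extC R i M R ⧸ LinearMap.range (LinearMap.lsmul R (extC R i M R) ℓ)) ≃ₗ[R]
      extC R (i + 1) (M ⧸ (Ideal.span {ℓ} • (⊤ : Submodule R M))) R) := by
  obtain ⟨δ, hL⟩ := exists_LES_ell M ℓ hℓ
  let φ : extC R i M R →ₗ[R] extC R (i + 1) (M ⧸ (Ideal.span {ℓ} • (⊤ : Submodule R M))) R := 
    ((bridge R (i + 1) (M ⧸ (Ideal.span {ℓ} • (⊤ : Submodule R M))) R).symm.toLinearMap ∘ₗ 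
      compL δ R (add_comm 1 i)) ∘ₗ (bridge R i M R).toLinearMap
  have hφ : ∀ x, φ x = (bridge R (i + 1) (M ⧸ (Ideal.span {ℓ} • (⊤ : Submodule R M))) R).symm
    (δ.comp (bridge R i M R x) (add_comm 1 i)) := fun x => rfl
  have hs : Function.Surjective φ := by
    intro y
    obtain ⟨z, hz⟩ := hL.con3 (add_comm 1 i) (bridge R (i + 1) _ R y) (by
      apply h2
      rw [← hm_smul_comp, hm_comp_assoc, hL.zero_fg, hm_zero, Abelian.Ext.zero_comp])
    refine ⟨(bridge R i M R).symm z, ?_⟩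
    rw [hφ, LinearEquiv.apply_symm_apply, hz, LinearEquiv.symm_apply_apply]
  have hk : LinearMap.range (LinearMap.lsmul R (extC R i M R) ℓ) = LinearMap.ker φ := by
    ext x
    rw [LinearMap.mem_range, LinearMap.mem_ker, hφ, LinearEquiv.map_eq_zero_iff]
    constructor
    · rintro ⟨y, rfl⟩
      rw [LinearMap.lsmul_apply, map_smul, ← hm_smul_comp,
        ← Abelian.Ext.comp_assoc δ (hm _) _ (add_zero 1) (zero_add i) (by omega), hL.df, 
        Abelian.Ext.zero_comp]
    · intro h
      obtain ⟨y, hy⟩ := hL.con1 _ _ h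
      rw [hm_smul_comp] at hy
      refine ⟨(bridge R i M R).symm y, ?_⟩
      rw [LinearMap.lsmul_apply, ← map_smul, hy, LinearEquiv.symm_apply_apply]
  exact ⟨(Submodule.quotEquivOfEq _ _ hk).trans (φ.quotKerEquivOfSurjective hs)⟩

end G1

set_option linter.unusedVariables false
set_option linter.unusedSectionVars false

section H1
open Limits Opposite

variable {R : Type} [CommRing R] (J : Ideal R)

noncomputable abbrev lcD (i : ℕ) := localCohomology.diagram (localCohomology.idealPowersDiagram J) i

instance lc_has (i : ℕ) : HasColimit (lcD J i) := 
  localCohomology.hasColimitDiagram.{0, 0} (localCohomology.idealPowersDiagram J) i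

noncomputable abbrev LC (i : ℕ) (M : Type) [AddCommGroup M] [Module R M] : Type :=
  ↥((localCohomology J i).obj (ModuleCat.of R M))

noncomputable abbrev lcF (i : ℕ) (M : Type) [AddCommGroup M] [Module R M] : (ℕᵒᵖ)ᵒᵖ ⥤ ModuleCat.{0} R :=
  lcD J i ⋙ (evaluation _ _).obj (ModuleCat.of R M)

noncomputable def lcCoc (i : ℕ) (M : Type) [AddCommGroup M] [Module R M] : Cocone (lcF J i M) :=
  ((evaluation _ _).obj (ModuleCat.of R M)).mapCocone (colimit.cocone (lcD J i))

noncomputable def lcIs (i : ℕ) (M : Type) [AddCommGroup M] [Module R M] : IsColimit (lcCoc J i M) :=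
  isColimitOfPreserves ((evaluation _ _).obj (ModuleCat.of R M)) (colimit.isColimit (lcD J i))

lemma lcCoc_pt (i : ℕ) (M : Type) [AddCommGroup M] [Module R M] : 
    (lcCoc J i M).pt = (localCohomology J i).obj (ModuleCat.of R M) := rfl

noncomputable def lcC0 (i : ℕ) (M : Type) [AddCommGroup M] [Module R M] (t : ℕ) : 
    extC R i (R ⧸ J ^ t) M →ₗ[R] LC J i M :=
  ((lcCoc J i M).ι.app (op (op t))).hom

noncomputable def trC (i : ℕ) (M : Type) [AddCommGroup M] [Module R M] {t s : ℕ} (h : t ≤ s) :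
    extC R i (R ⧸ J ^ t) M →ₗ[R] extC R i (R ⧸ J ^ s) M :=
  (((Ext R (ModuleCat.{0} R) i).map (ModuleCat.ofHom (pr J h)).op).app (ModuleCat.of R M)).hom

lemma bridge_trC (i : ℕ) (M : Type) [AddCommGroup M] [Module R M] {t s : ℕ} (h : t ≤ s)
    (x : extC R i (R ⧸ J ^ t) M) :
    bridge R i (R ⧸ J ^ s) M (trC J i M h x) = preL (pr J h) M i (bridge R i (R ⧸ J ^ t) M x) := by
  have := bridgeC_map (Y := ModuleCat.of R M) (n := i) (ModuleCat.ofHom (pr J h)) x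
  refine Eq.trans ?_ this
  rfl

lemma lcF_map (i : ℕ) (M : Type) [AddCommGroup M] [Module R M] {t s : ℕ} (h : t ≤ s)
    (f : (op (op t) : ℕᵒᵖᵒᵖ) ⟶ op (op s)) : ((lcF J i M).map f).hom = trC J i M h := rfl

lemma lcC0_compat (i : ℕ) (M : Type) [AddCommGroup M] [Module R M] {t s : ℕ} (h : t ≤ s)
    (x : extC R i (R ⧸ J ^ t) M) : lcC0 J i M s (trC J i M h x) = lcC0 J i M t x := by
  have := (lcCoc J i M).w (homOfLE h).op.op
  exact congrArg (fun f => f.hom x) this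

lemma lcC0_surj (i : ℕ) (M : Type) [AddCommGroup M] [Module R M] (y : LC J i M) :
    ∃ (t : ℕ) (x : extC R i (R ⧸ J ^ t) M), lcC0 J i M t x = y := by
  obtain ⟨⟨⟨t⟩⟩, x, hx⟩ := Concrete.isColimit_exists_rep (lcF J i M) (lcIs J i M) y
  exact ⟨t, x, hx⟩

lemma lcC0_zero (i : ℕ) (M : Type) [AddCommGroup M] [Module R M] (t : ℕ) 
    (x : extC R i (R ⧸ J ^ t) M) (hx : lcC0 J i M t x = 0) : 
    ∃ (s : ℕ) (h : t ≤ s), trC J i M h x = 0 := by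
  have h0 : lcC0 J i M t x = lcC0 J i M t 0 := hx.trans (map_zero (lcC0 J i M t)).symm
  obtain ⟨⟨⟨s⟩⟩, f, g, h⟩ := (Concrete.isColimit_rep_eq_iff_exists (lcF J i M) (lcIs J i M) 
    (i := op (op t)) (j := op (op t)) x (0 : extC R i (R ⧸ J ^ t) M)).mp h0
  have hts : t ≤ s := leOfHom f.unop.unop
  refine ⟨s, hts, ?_⟩
  exact h.trans (map_zero (trC J i M hts))

noncomputable def lcC (i : ℕ) (M : Type) [AddCommGroup M] [Module R M] (t : ℕ) : 
    EX R (R ⧸ J ^ t) M i →ₗ[R] LC J i M :=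
  lcC0 J i M t ∘ₗ (bridge R i (R ⧸ J ^ t) M).symm.toLinearMap

lemma lcC_bridge (i : ℕ) (M : Type) [AddCommGroup M] [Module R M] (t : ℕ) 
    (x : extC R i (R ⧸ J ^ t) M) : lcC J i M t (bridge R i (R ⧸ J ^ t) M x) = lcC0 J i M t x := 
  congrArg (lcC0 J i M t) (LinearEquiv.symm_apply_apply _ _)

lemma lcC_compat (i : ℕ) (M : Type) [AddCommGroup M] [Module R M] {t s : ℕ} (h : t ≤ s) 
    (x : EX R (R ⧸ J ^ t) M i) : lcC J i M s (preL (pr J h) M i x) = lcC J i M t x := by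
  obtain ⟨x, rfl⟩ := (bridge R i (R ⧸ J ^ t) M).surjective x
  rw [← bridge_trC, lcC_bridge, lcC_bridge, lcC0_compat]

lemma lcC_surj (i : ℕ) (M : Type) [AddCommGroup M] [Module R M] (y : LC J i M) :
    ∃ t x, lcC J i M t x = y := by
  obtain ⟨t, x, hx⟩ := lcC0_surj J i M y
  exact ⟨t, bridge R i _ M x, (lcC_bridge _ _ _ _ _).trans hx⟩

lemma lcC_zero (i : ℕ) (M : Type) [AddCommGroup M] [Module R M] (t : ℕ) (x : EX R (R ⧸ J ^ t) M i)
    (hx : lcC J i M t x = 0) : ∃ (s : ℕ) (h : t ≤ s), preL (pr J h) M i x = 0 := by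
  obtain ⟨x, rfl⟩ := (bridge R i (R ⧸ J ^ t) M).surjective x
  rw [lcC_bridge] at hx
  obtain ⟨s, h, h0⟩ := lcC0_zero J i M t x hx
  refine ⟨s, h, ?_⟩
  rw [← bridge_trC, h0, map_zero]

end H1

set_option linter.unusedVariables false
set_option linter.unusedSectionVars false

section H2

variable {R : Type} [CommRing R]

lemma desc_gen (F : ℕ → Type) [∀ t, AddCommGroup (F t)] [∀ t, Module R (F t)]
    (tr : ∀ {t s : ℕ}, t ≤ s → F t →ₗ[R] F s) (L : Type) [AddCommGroup L] [Module R L]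
    (c : ∀ t, F t →ₗ[R] L) (hc : ∀ {t s : ℕ} (h : t ≤ s) (x : F t), c s (tr h x) = c t x)
    (hs : ∀ y, ∃ t x, c t x = y) 
    (L' : Type) [AddCommGroup L'] [Module R L'] (d : ∀ t, F t →ₗ[R] L')
    (hd : ∀ {t s : ℕ} (h : t ≤ s) (x : F t), d s (tr h x) = d t x)
    (hcd : ∀ t x, c t x = 0 → d t x = 0) : 
    ∃ Φ : L →ₗ[R] L', ∀ t x, Φ (c t x) = d t x := by
  have h1 : ∀ t s (x : F t) (y : F s), c t x = c s y → d t x = d s y := by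
    intro t s x y h
    rw [← hc (le_max_left t s), ← hc (le_max_right t s) y, ← sub_eq_zero, ← map_sub] at h
    have := hcd _ _ h
    rwa [map_sub, hd, hd, sub_eq_zero] at this
  choose T X hX using hs
  have h2 : ∀ t x, d (T (c t x)) (X (c t x)) = d t x := fun t x => h1 _ _ _ _ (hX _)
  refine ⟨{ toFun := fun y => d (T y) (X y), map_add' := ?_, map_smul' := ?_ }, h2⟩
  · intro y z
    have : c (max (T y) (T z)) (tr (le_max_left _ _) (X y) + tr (le_max_right _ _) (X z)) = y + z := by
      rw [map_add, hc, hc, hX, hX]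
    rw [h1 _ _ _ _ ((hX _).trans this.symm), map_add, hd, hd]
  · intro r y
    have : c (T y) (r • X y) = r • y := by rw [map_smul, hX]
    rw [h1 _ _ _ _ ((hX _).trans this.symm), map_smul]; rfl

variable {m : Ideal R} {n : ℕ} [IsNoetherianRing R]

lemma part2surj (L : LDat R m n) (M : Type) [AddCommGroup M] [Module R M] [Module.Finite R M] (ℓ : R)
    (hr : ∀ j ≤ n, ∀ e : EX R M R j, ℓ • e = 0 → e = 0) (i : ℕ) (t : ℕ)
    (α : EX R (R ⧸ m ^ t) M i) : 
    ∃ (s : ℕ) (h : t ≤ s) (β : EX R (R ⧸ m ^ s) M i), preL (pr m h) M i α = ℓ • β := by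
  by_cases hi : i ≤ n
  · exact L.claimS (Nat.add_sub_cancel' hi) M ℓ (hr _ (Nat.sub_le _ _)) t α
  · refine ⟨t, le_rfl, 0, ?_⟩
    rw [L.V2 (kil_quot (m ^ t)) (by omega) α, map_zero, smul_zero]

lemma part2 (L : LDat R m n) (M : Type) [AddCommGroup M] [Module R M] [Module.Finite R M] (ℓ : R)
    (hM : ∀ x : M, ℓ • x = 0 → x = 0)
    (hr : ∀ j ≤ n, ∀ e : EX R M R j, ℓ • e = 0 → e = 0) (i : ℕ) :
    (Function.Surjective fun y : LC m (i + 1) M => ℓ • y) ∧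
    Nonempty (LinearMap.ker (LinearMap.lsmul R (LC m (i + 1) M) ℓ) ≃ₗ[R]
      LC m i (M ⧸ (Ideal.span {ℓ} • (⊤ : Submodule R M)))) := by
  constructor
  · intro y
    obtain ⟨t, α, rfl⟩ := lcC_surj m (i + 1) M y
    obtain ⟨s, h, β, hβ⟩ := part2surj L M ℓ hr _ t α
    refine ⟨lcC m (i + 1) M s β, ?_⟩
    change ℓ • lcC m (i + 1) M s β = _
    rw [← map_smul, ← hβ, lcC_compat]
  obtain ⟨δ, hL⟩ := exists_LES_ell M ℓ hM
  obtain ⟨Φ, hΦ⟩ := desc_gen (fun t => EX R (R ⧸ m ^ t) (M ⧸ (Ideal.span {ℓ} • (⊤ : Submodule R M))) i)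
    (fun h => preL (pr m h) _ i) (LC m i (M ⧸ (Ideal.span {ℓ} • (⊤ : Submodule R M))))
    (lcC m i _) (lcC_compat m i _) (lcC_surj m i _) (LC m (i + 1) M) 
    (fun t => lcC m (i + 1) M t ∘ₗ compR _ δ rfl) (by
      intro t s h x
      refine Eq.trans ?_ (lcC_compat m (i + 1) M h _)
      refine congrArg (lcC m (i + 1) M s) ?_
      exact (preL_comp (pr m h) x δ rfl).symm) (by
      intro t x hx
      obtain ⟨s, h, h0⟩ := lcC_zero m i _ t x hx
      refine (lcC_compat m (i + 1) M h _).symm.trans ?_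
      refine (congrArg (lcC m (i + 1) M s) ?_).trans (map_zero _)
      refine (preL_comp (pr m h) x δ rfl).trans ?_
      rw [h0, Abelian.Ext.zero_comp])
  have hΦ' : ∀ t x, Φ (lcC m i _ t x) = lcC m (i + 1) M t (x.comp δ rfl) := hΦ
  have hinj : Function.Injective Φ := by
    rw [injective_iff_map_eq_zero]
    intro y hy
    obtain ⟨t, x, rfl⟩ := lcC_surj m i _ y
    rw [hΦ'] at hy
    obtain ⟨s, h, h0⟩ := lcC_zero m (i + 1) M t _ hy
    rw [preL_comp] at h0
    obtain ⟨z, hz⟩ := hL.co3 _ _ h0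
    obtain ⟨u, hu, β, hβ⟩ := part2surj L M ℓ hr i s z
    rw [← lcC_compat m i _ h, ← lcC_compat m i _ hu, ← hz, preL_comp, hβ, ← comp_hm_smul,
      Abelian.Ext.comp_assoc _ _ _ (add_zero i) (zero_add 0) (by omega), hm_comp, hL.zero_fg, hm_zero,
      Abelian.Ext.comp_zero, map_zero]
  have hran : LinearMap.range Φ = LinearMap.ker (LinearMap.lsmul R (LC m (i + 1) M) ℓ) := by
    ext y
    rw [LinearMap.mem_range, LinearMap.mem_ker, LinearMap.lsmul_apply]
    constructor
    · rintro ⟨w, rfl⟩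
      obtain ⟨t, x, rfl⟩ := lcC_surj m i _ w
      rw [hΦ', ← map_smul, ← comp_hm_smul, 
        Abelian.Ext.comp_assoc _ _ _ rfl (add_zero 1) (by omega), hL.df, Abelian.Ext.comp_zero,
        map_zero]
    · intro hy
      obtain ⟨t, x, rfl⟩ := lcC_surj m (i + 1) _ y
      rw [← map_smul] at hy
      obtain ⟨s, h, h0⟩ := lcC_zero m (i + 1) M t _ hy
      rw [map_smul, ← comp_hm_smul] at h0
      obtain ⟨z, hz⟩ := hL.co1 rfl _ h0
      exact ⟨lcC m i _ s z, by rw [hΦ', hz, lcC_compat]⟩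
  exact ⟨((LinearEquiv.ofInjective Φ hinj).trans (LinearEquiv.ofEq _ _ hran)).symm⟩

end H2

/-- Let `R = k[x_1, …, x_n]` (`k` infinite) and `M ≠ 0` a finitely generated
ℤ-graded `R`-module with positive depth and positive E-depth, and let `ℓ` be a linear form
which is strictly filter regular for `M`.  Then the short exact sequence
`0 → M(-1) →ℓ M → M/ℓM → 0` induces short exact sequences
`0 → Ext^i_R(M, R) →ℓ Ext^i_R(M, R)(1) → Ext^{i+1}_R(M/ℓM, R) → 0` for all `i < n`
(multiplication by `ℓ` is injective on `Ext^i_R(M, R)` with cokernel `Ext^{i+1}_R(M/ℓM, R)`),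
and `0 → H^{i-1}_𝔪(M/ℓM) → H^i_𝔪(M)(-1) →ℓ H^i_𝔪(M) → 0` for all `i > 0`
(multiplication by `ℓ` is surjective on `H^i_𝔪(M)` with kernel `H^{i-1}_𝔪(M/ℓM)`).
(The degree shifts `(1)`, `(-1)` only affect the grading and are suppressed, the
underlying modules being unchanged.) -/
theorem stmt18 (k : Type) [Field k] [Infinite k] (n : ℕ)
    (M : Type) [AddCommGroup M] [Module (MvPolynomial (Fin n) k) M] [Module k M]
    [IsScalarTower k (MvPolynomial (Fin n) k) M] [Module.Finite (MvPolynomial (Fin n) k) M]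
    [Nontrivial M]
    (𝒜 : ℤ → Submodule k M) (hinternal : DirectSum.IsInternal 𝒜)
    (hcompat : ∀ (e : ℕ) (f : MvPolynomial (Fin n) k), f.IsHomogeneous e →
      ∀ (d' : ℤ), ∀ x ∈ 𝒜 d', f • x ∈ 𝒜 (d' + (e : ℤ)))
    (hdepth : 0 < mDepth (MvPolynomial (Fin n) k) (irrIdeal k n) M)
    (hEdepth : 0 < eDepth k n M)
    (ℓ : MvPolynomial (Fin n) k) (hlin : ℓ.IsHomogeneous 1)
    (hsfr : IsSFRg k n ℓ M) :
    (∀ i : ℕ, i < n →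
      (∀ y : extC (MvPolynomial (Fin n) k) i M (MvPolynomial (Fin n) k),
        ℓ • y = 0 → y = 0) ∧
      Nonempty
        ((extC (MvPolynomial (Fin n) k) i M (MvPolynomial (Fin n) k) ⧸
            LinearMap.range (LinearMap.lsmul (MvPolynomial (Fin n) k)
              (extC (MvPolynomial (Fin n) k) i M (MvPolynomial (Fin n) k)) ℓ))
          ≃ₗ[MvPolynomial (Fin n) k]
         extC (MvPolynomial (Fin n) k) (i + 1)
           (M ⧸ (Ideal.span {ℓ} • (⊤ : Submodule (MvPolynomial (Fin n) k) M)))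
           (MvPolynomial (Fin n) k))) ∧
    (∀ i : ℕ, 0 < i →
      (Function.Surjective fun y : locCoh k n i M => ℓ • y) ∧
      Nonempty
        (↥(LinearMap.ker (LinearMap.lsmul (MvPolynomial (Fin n) k) (locCoh k n i M) ℓ))
          ≃ₗ[MvPolynomial (Fin n) k]
         locCoh k n (i - 1)
           (M ⧸ (Ideal.span {ℓ} • (⊤ : Submodule (MvPolynomial (Fin n) k) M))))) := by
  have hreg := regEX k n M hdepth hEdepth ℓ hsfr
  have hM := regM k n M ℓ hreg
  refine ⟨fun i hi => ⟨regE k n M hdepth hEdepth ℓ hsfr i hi.le, part1 M ℓ hM i (hreg (i + 1) hi)⟩, ?_⟩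
  intro i hi
  obtain ⟨i, rfl⟩ := Nat.exists_eq_succ_of_ne_zero hi.ne'
  exact part2 (lDat_poly k n) M ℓ hM hreg i
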